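/- arXiv:1906.00385 — 2 statements merged into one kernel-verified Lean document; each statement's English description precedes it below -/
import Mathlib

section
/- Let Ω ∈ K^n/ℤ^n, 𝒟_Ω ⊆ 𝔻_Ω, and let M be a nonzero module in GW(𝕀_n, 𝒟_Ω). Then: (1) Supp(M) = Supp(M(𝒟_Ω)); (2) ann_{𝕀_n}(M) = 𝔞(𝒟_Ω) := Σ_{i∈C𝒟_Ω} 𝔭_i, where C𝒟_Ω = {1,…,n}∖𝒟_Ω, and this ideal is prime. Consequently, every nonzero module in GW(𝕀_n, 𝒟_Ω) is an absolutely 𝔞(𝒟_Ω)-prime 𝕀_n-module. -/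
set_option maxHeartbeats 1000000
set_option synthInstance.maxHeartbeats 400000
set_option linter.unusedSectionVars false

namespace IDO

open scoped TensorProduct

noncomputable section

variable (K : Type*) [Field K] [CharZero K] (n : ℕ)

/-- The polynomial algebra `P_n = K[x_1, …, x_n]`. -/
abbrev P := MvPolynomial (Fin n) K

/-- The multiplication operator `x_i`. -/
def xOp (i : Fin n) : Module.End K (P K n) := LinearMap.mulLeft K (MvPolynomial.X i)

/-- The partial derivative `∂_i`. -/
def dOp (i : Fin n) : Module.End K (P K n) := (MvPolynomial.pderiv i).toLinearMap

/-- The integration operator `∫_i`, sending `x^α ↦ x^{α+e_i}/(α_i+1)`. -/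
def intOp (i : Fin n) : Module.End K (P K n) :=
  ((MvPolynomial.basisMonomials (Fin n) K).constr K)
    (fun α => (((α i : ℕ) : K) + 1)⁻¹ •
      (MvPolynomial.monomial (α + Finsupp.single i 1) (1 : K)))

/-- The algebra of polynomial integro-differential operators `𝕀_n`, as a subalgebra of
`End_K(P_n)` generated by the `x_i`, `∂_i` and `∫_i`. -/
def InSub : Subalgebra K (Module.End K (P K n)) :=
  Algebra.adjoin K (Set.range (xOp K n) ∪ Set.range (dOp K n) ∪ Set.range (intOp K n))

/-- The algebra `𝕀_n` (as a type, with its canonical ring structure). -/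
def In : Type _ := InSub K n

instance : Ring (In K n) := inferInstanceAs (Ring (InSub K n))
instance : Algebra K (In K n) := inferInstanceAs (Algebra K (InSub K n))
instance : Module (In K n) (P K n) := inferInstanceAs (Module (InSub K n) (P K n))
instance : IsScalarTower K (In K n) (P K n) :=
  inferInstanceAs (IsScalarTower K (InSub K n) (P K n))

/-- `x_i` as an element of `𝕀_n`. -/
def xEl (i : Fin n) : In K n :=
  show InSub K n from
    ⟨xOp K n i, Algebra.subset_adjoin (Set.mem_union_left _ (Set.mem_union_left _ ⟨i, rfl⟩))⟩

/-- `∂_i` as an element of `𝕀_n`. -/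
def dEl (i : Fin n) : In K n :=
  show InSub K n from
    ⟨dOp K n i, Algebra.subset_adjoin (Set.mem_union_left _ (Set.mem_union_right _ ⟨i, rfl⟩))⟩

/-- `∫_i` as an element of `𝕀_n`. -/
def intEl (i : Fin n) : In K n :=
  show InSub K n from
    ⟨intOp K n i, Algebra.subset_adjoin (Set.mem_union_right _ ⟨i, rfl⟩)⟩

/-- `H_i = ∂_i x_i` as an element of `𝕀_n`. -/
def HEl (i : Fin n) : In K n := dEl K n i * xEl K n i

section Modules

variable (M : Type*) [AddCommGroup M] [Module K M] [Module (In K n) M]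
  [IsScalarTower K (In K n) M]

/-- The weight space `M_λ = {m | H_i m = λ_i m for all i}`. -/
def weightSpace (lam : Fin n → K) : Submodule K M where
  carrier := {m | ∀ i, HEl K n i • m = lam i • m}
  add_mem' := by
    intro a b ha hb i
    rw [smul_add, ha i, hb i, smul_add]
  zero_mem' := by intro i; simp
  smul_mem' := by
    intro c m hm i
    rw [← smul_comm c (HEl K n i) m, hm i, smul_smul, mul_comm, ← smul_smul]

private lemma pow_smul_zero_mono {a : In K n} {m : M} {s s' : ℕ}
    (h : (a ^ s) • m = 0) (hle : s ≤ s') : (a ^ s') • m = 0 := by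
  obtain ⟨k, rfl⟩ := Nat.exists_eq_add_of_le hle
  rw [add_comm s k, pow_add, mul_smul, h, smul_zero]

/-- The generalized weight space `M^λ = {m | (H_i − λ_i)^N m = 0 for some N and all i}`. -/
def genWeightSpace (lam : Fin n → K) : Submodule K M where
  carrier := {m | ∃ N : ℕ, ∀ i,
    ((HEl K n i - algebraMap K (In K n) (lam i)) ^ N) • m = 0}
  add_mem' := by
    rintro a b ⟨Na, ha⟩ ⟨Nb, hb⟩
    refine ⟨Na ⊔ Nb, fun i => ?_⟩
    rw [smul_add, pow_smul_zero_mono K n M (ha i) le_sup_left,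
      pow_smul_zero_mono K n M (hb i) le_sup_right, add_zero]
  zero_mem' := ⟨0, fun i => smul_zero _⟩
  smul_mem' := by
    rintro c m ⟨N, hN⟩
    exact ⟨N, fun i => by rw [← smul_comm c _ m, hN i, smul_zero]⟩

/-- `M` is a weight module: `M = ⊕_λ M_λ`. -/
def IsWeightModule : Prop :=
  letI := Classical.decEq (Fin n → K)
  DirectSum.IsInternal (fun lam : Fin n → K => weightSpace K n M lam)

/-- `M` is a generalized weight module: `M = ⊕_λ M^λ`. -/
def IsGenWeightModule : Prop :=
  letI := Classical.decEq (Fin n → K)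
  DirectSum.IsInternal (fun lam : Fin n → K => genWeightSpace K n M lam)

/-- The support `Supp(M) = {λ | M^λ ≠ 0}`. -/
def supp : Set (Fin n → K) := {lam | genWeightSpace K n M lam ≠ ⊥}

/-- `M` is an indecomposable `𝕀_n`-module. -/
def IsIndecomposableMod : Prop :=
  Nontrivial M ∧ ∀ p q : Submodule (In K n) M, IsCompl p q → p = ⊥ ∨ q = ⊥

/-- The annihilator of an `𝕀_n`-module, as a set. -/
def annSet : Set (In K n) := {a | ∀ m : M, a • m = 0}

end Modules

/-- A prime (two-sided) ideal of the noncommutative ring `𝕀_n`, given as a set: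
`S ≠ 𝕀_n` and `a 𝕀_n b ⊆ S → a ∈ S ∨ b ∈ S`. -/
def IsPrimeSet (S : Set (In K n)) : Prop :=
  S ≠ Set.univ ∧ ∀ a b : In K n, (∀ r : In K n, a * r * b ∈ S) → a ∈ S ∨ b ∈ S

-- orbits
/-- The `ℤ^n`-orbit of `λ ∈ K^n`. -/
def orbitOf (lam : Fin n → K) : Set (Fin n → K) :=
  {mu | ∀ i, ∃ z : ℤ, mu i - lam i = (z : K)}

/-- The setoid on `K^n` whose classes are the `ℤ^n`-orbits. -/
def orbitSetoid : Setoid (Fin n → K) where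
  r mu nu := ∀ i, ∃ z : ℤ, mu i - nu i = (z : K)
  iseqv := by
    constructor
    · intro x i; exact ⟨0, by simp⟩
    · intro x y h i
      obtain ⟨z, hz⟩ := h i
      exact ⟨-z, by push_cast; linear_combination -hz⟩
    · intro x y z hxy hyz i
      obtain ⟨a, ha⟩ := hxy i
      obtain ⟨b, hb⟩ := hyz i
      exact ⟨a + b, by push_cast; linear_combination ha + hb⟩

/-- `𝔻_Ω = {i | Ω_i = ℤ}` for the orbit `Ω` of `λ`. -/
def DD (lam : Fin n → K) : Set (Fin n) := {i | ∃ z : ℤ, lam i = (z : K)}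

/-- `λ` is the normalized representative of its orbit: integer coordinates are `0`. -/
def IsNormalized (lam : Fin n → K) : Prop := ∀ i, (∃ z : ℤ, lam i = (z : K)) → lam i = 0


-- I_1 specifics
/-- The matrix units `e_{st} = ∫^s ∂^t − ∫^{s+1} ∂^{t+1}` of `𝕀_1`. -/
def eEl1 (s t : ℕ) : In K 1 :=
  intEl K 1 0 ^ s * dEl K 1 0 ^ t - intEl K 1 0 ^ (s + 1) * dEl K 1 0 ^ (t + 1)

/-- `F = ⊕ K e_{st}`, the unique proper two-sided ideal of `𝕀_1`, here as the left ideal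
generated by the `e_{st}` (the two coincide). -/
def Fideal : Submodule (In K 1) (In K 1) :=
  Submodule.span (In K 1) {a | ∃ s t : ℕ, a = eEl1 K s t}

/-- The left ideal `F + 𝕀_1 (H − μ)^s`. -/
def MslIdeal (s : ℕ) (mu : K) : Submodule (In K 1) (In K 1) :=
  Fideal K ⊔ Submodule.span (In K 1) {(HEl K 1 0 - algebraMap K (In K 1) mu) ^ s}

/-- The `𝕀_1`-module `M(s,μ) = 𝕀_1/(F + 𝕀_1 (H − μ)^s)`. -/
def Msl (s : ℕ) (mu : K) := (In K 1) ⧸ MslIdeal K s mu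

instance (s : ℕ) (mu : K) : AddCommGroup (Msl K s mu) :=
  inferInstanceAs (AddCommGroup ((In K 1) ⧸ MslIdeal K s mu))
instance (s : ℕ) (mu : K) : Module (In K 1) (Msl K s mu) :=
  inferInstanceAs (Module (In K 1) ((In K 1) ⧸ MslIdeal K s mu))
instance (s : ℕ) (mu : K) : Module K (Msl K s mu) :=
  inferInstanceAs (Module K ((In K 1) ⧸ MslIdeal K s mu))
instance (s : ℕ) (mu : K) : IsScalarTower K (In K 1) (Msl K s mu) :=
  inferInstanceAs (IsScalarTower K (In K 1) ((In K 1) ⧸ MslIdeal K s mu))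

-- two-sided ideals of I_n
/-- The element `e_{st}(i) ∈ 𝕀_n` built from the `i`-th tensor factor. -/
def eElN (i : Fin n) (s t : ℕ) : In K n :=
  intEl K n i ^ s * dEl K n i ^ t - intEl K n i ^ (s + 1) * dEl K n i ^ (t + 1)

/-- The height one prime `𝔭_i`, the two-sided ideal of `𝕀_n` generated by `F(i)`. -/
def pIdeal (i : Fin n) : TwoSidedIdeal (In K n) :=
  TwoSidedIdeal.span {a | ∃ s t : ℕ, a = eElN K n i s t}

/-- `𝔞_n(I) = Σ_{i ∈ I} 𝔭_i`. -/
def aIdeal (I : Set (Fin n)) : TwoSidedIdeal (In K n) := ⨆ i ∈ I, pIdeal K n i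


-- bundled modules
universe u

/-- A bundled `𝕀_n`-module (with compatible `K`-structure). -/
structure ModN (K : Type u) [Field K] [CharZero K] (n : ℕ) : Type (u + 1) where
  carrier : Type u
  [instAdd : AddCommGroup carrier]
  [instK : Module K carrier]
  [instIn : Module (In K n) carrier]
  [instTower : IsScalarTower K (In K n) carrier]

attribute [instance] ModN.instAdd ModN.instK ModN.instIn ModN.instTower

/-- The endomorphism of `M_1 ⊗ ⋯ ⊗ M_n` acting by `a ∈ 𝕀_1` on the `i`-th factor. -/
def tprodMap (Mi : Fin n → ModN K 1) (i : Fin n) (a : In K 1) :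
    (⨂[K] j, (Mi j).carrier) →ₗ[K] ⨂[K] j, (Mi j).carrier :=
  PiTensorProduct.map (Function.update
    (fun j => (LinearMap.id : (Mi j).carrier →ₗ[K] (Mi j).carrier)) i
    (DistribMulAction.toLinearMap K ((Mi i).carrier) a))

/-- The `𝕀_n`-module `M` "is" the tensor product `M_1 ⊗ ⋯ ⊗ M_n` of the `𝕀_1`-modules `M_i`:
there is a `K`-linear isomorphism under which the generators `x_i, ∂_i, ∫_i` of `𝕀_n` act on
the `i`-th tensor factor via the corresponding generators of `𝕀_1`. -/
def RealizesTensor (Mi : Fin n → ModN K 1) (M : Type*) [AddCommGroup M] [Module K M]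
    [Module (In K n) M] [IsScalarTower K (In K n) M] : Prop :=
  ∃ φ : M ≃ₗ[K] ⨂[K] j, (Mi j).carrier,
    ∀ (i : Fin n) (m : M),
      φ (xEl K n i • m) = tprodMap K n Mi i (xEl K 1 0) (φ m) ∧
      φ (dEl K n i • m) = tprodMap K n Mi i (dEl K 1 0) (φ m) ∧
      φ (intEl K n i • m) = tprodMap K n Mi i (intEl K 1 0) (φ m)

/-- `M` is (isomorphic to) the simple weight module `M(𝒟_Ω)` attached to the orbit of `λ`
and the subset `𝒟 ⊆ 𝔻_Ω`: the tensor product of copies of `K[x]` (for `i ∈ 𝒟`) and of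
`M(1, λ_i)` (for `i ∉ 𝒟`). -/
def RealizesMD (lam : Fin n → K) (D : Set (Fin n)) (M : Type*) [AddCommGroup M] [Module K M]
    [Module (In K n) M] [IsScalarTower K (In K n) M] : Prop :=
  ∃ Mi : Fin n → ModN K 1,
    (∀ i, i ∈ D → Nonempty ((Mi i).carrier ≃ₗ[In K 1] P K 1)) ∧
    (∀ i, i ∉ D → Nonempty ((Mi i).carrier ≃ₗ[In K 1] Msl K 1 (lam i))) ∧
    RealizesTensor K n Mi M

/-- `M` is (isomorphic to) the module `P_{n-1} ⊗ M(s, λ)` (with the copy of `M(s,λ)` placed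
in position `j`). -/
def RealizesPMs (lam : Fin n → K) (j : Fin n) (s : ℕ) (M : Type*) [AddCommGroup M] [Module K M]
    [Module (In K n) M] [IsScalarTower K (In K n) M] : Prop :=
  ∃ Mi : Fin n → ModN K 1,
    (∀ i, i ≠ j → Nonempty ((Mi i).carrier ≃ₗ[In K 1] P K 1)) ∧
    Nonempty ((Mi j).carrier ≃ₗ[In K 1] Msl K s (lam j)) ∧
    RealizesTensor K n Mi M

/-- Membership in the category `GW(𝕀_n, 𝒟_Ω)`: generalized weight modules with support in the
orbit of `λ` all of whose simple subquotients are isomorphic to `M(𝒟_Ω)`. -/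
def InGWD (lam : Fin n → K) (D : Set (Fin n)) (M : Type*) [AddCommGroup M] [Module K M]
    [Module (In K n) M] [IsScalarTower K (In K n) M] : Prop :=
  IsGenWeightModule K n M ∧ supp K n M ⊆ orbitOf K n lam ∧
  ∀ (p q : Submodule (In K n) M), p ≤ q →
    IsSimpleModule (In K n) (q ⧸ Submodule.comap q.subtype p) →
    RealizesMD K n lam D (q ⧸ Submodule.comap q.subtype p)

/-- The support `S(𝒟_Ω) = ℕ_+^{𝒟_Ω} × ∏_{i ∉ 𝒟_Ω} (λ_i + ℤ)` of the module `M(𝒟_Ω)`. -/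
def SuppMD (lam : Fin n → K) (D : Set (Fin n)) : Set (Fin n → K) :=
  {mu | (∀ i ∈ D, ∃ m : ℕ, 0 < m ∧ mu i = (m : K)) ∧
        (∀ i ∉ D, ∃ z : ℤ, mu i = lam i + (z : K))}

/-- `M` is an absolutely prime `𝕀_n`-module: its annihilator is a prime ideal and every
nonzero subfactor of `M` has the same annihilator. -/
def IsAbsolutelyPrime (M : Type*) [AddCommGroup M] [Module K M]
    [Module (In K n) M] [IsScalarTower K (In K n) M] : Prop :=
  IsPrimeSet K n (annSet K n M) ∧
  ∀ (p q : Submodule (In K n) M), p ≤ q →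
    Nontrivial (q ⧸ Submodule.comap q.subtype p) →
    annSet K n (q ⧸ Submodule.comap q.subtype p) = annSet K n M


-- the commutative subalgebra D_n = K[H_1, …, H_n]
lemma xEl_smul (i : Fin n) (p : P K n) : xEl K n i • p = MvPolynomial.X i * p := rfl

lemma dEl_smul (i : Fin n) (p : P K n) : dEl K n i • p = MvPolynomial.pderiv i p := rfl

lemma hEl_monomial (i : Fin n) (α : Fin n →₀ ℕ) (c : K) :
    HEl K n i • (MvPolynomial.monomial α c : P K n)
      = (((α i : ℕ) : K) + 1) • MvPolynomial.monomial α c := by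
  have hx : xEl K n i • (MvPolynomial.monomial α c : P K n)
      = MvPolynomial.monomial (α + Finsupp.single i 1) c := by
    rw [xEl_smul, MvPolynomial.X, MvPolynomial.monomial_mul, one_mul, add_comm]
  rw [HEl, mul_smul, hx, dEl_smul, MvPolynomial.pderiv_monomial,
    add_tsub_cancel_right, MvPolynomial.smul_monomial, Finsupp.add_apply,
    Finsupp.single_eq_same, smul_eq_mul]
  congr 1
  push_cast
  ring

private lemma In_ext {a b : In K n} (h : ∀ p : P K n, a • p = b • p) : a = b := by
  have : (show InSub K n from a) = (show InSub K n from b) :=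
    Subtype.ext (LinearMap.ext fun p => h p)
  exact this

lemma hEl_comm (i j : Fin n) : HEl K n i * HEl K n j = HEl K n j * HEl K n i := by
  apply In_ext
  intro p
  induction p using MvPolynomial.induction_on' with
  | monomial α c =>
      have key : ∀ a b : Fin n, (HEl K n a * HEl K n b) • (MvPolynomial.monomial α c : P K n)
          = ((((α b : ℕ) : K) + 1) * (((α a : ℕ) : K) + 1)) • MvPolynomial.monomial α c := by
        intro a b
        rw [mul_smul, hEl_monomial, ← smul_comm, hEl_monomial, smul_smul]
      rw [key, key, mul_comm]
  | add p q hp hq =>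
      rw [smul_add, smul_add, hp, hq]

/-- `D_n = K[H_1, …, H_n]` as a subalgebra of `𝕀_n`. -/
def DnSub : Subalgebra K (In K n) := Algebra.adjoin K (Set.range (HEl K n))

/-- The commutative algebra `D_n` (as a type). -/
def Dn : Type _ := DnSub K n

instance : CommRing (Dn K n) :=
  Algebra.adjoinCommRingOfComm K (by rintro a ⟨i, rfl⟩ b ⟨j, rfl⟩; exact hEl_comm K n i j)

instance : Algebra K (Dn K n) := inferInstanceAs (Algebra K (DnSub K n))

/-- The inclusion `D_n → 𝕀_n`. -/
def dnVal : Dn K n →+* In K n := ((DnSub K n).val : DnSub K n →ₐ[K] In K n).toRingHom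

/-- `H_i` as an element of `D_n`. -/
def HElD (i : Fin n) : Dn K n :=
  show DnSub K n from ⟨HEl K n i, Algebra.subset_adjoin ⟨i, rfl⟩⟩

lemma dn_comm (d : Dn K n) (i : Fin n) :
    dnVal K n d * HEl K n i = HEl K n i * dnVal K n d := by
  have h1 : DnSub K n ≤ Subalgebra.centralizer K (Set.range (HEl K n)) := by
    apply Algebra.adjoin_le
    rintro x ⟨j, rfl⟩
    rw [SetLike.mem_coe, Subalgebra.mem_centralizer_iff]
    rintro g ⟨i', rfl⟩
    exact hEl_comm K n i' j
  have h2 := (Subalgebra.mem_centralizer_iff K).mp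
    (h1 (show DnSub K n from d).2) (HEl K n i) ⟨i, rfl⟩
  exact h2.symm


section DnModules

variable (M : Type*) [AddCommGroup M] [Module K M] [Module (In K n) M]
  [IsScalarTower K (In K n) M]

lemma genWS_stable (lam : Fin n → K) {m : M} (hm : m ∈ genWeightSpace K n M lam)
    (d : Dn K n) : dnVal K n d • m ∈ genWeightSpace K n M lam := by
  obtain ⟨N, hN⟩ := hm
  refine ⟨N, fun i => ?_⟩
  have hc : Commute (dnVal K n d) ((HEl K n i - algebraMap K (In K n) (lam i)) ^ N) := by
    apply Commute.pow_right
    exact Commute.sub_right (dn_comm K n d i) ((Algebra.commutes (lam i) (dnVal K n d)).symm)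
  rw [← mul_smul, ← hc.eq, mul_smul, hN i, smul_zero]

instance genWS_smul (lam : Fin n → K) : SMul (Dn K n) (genWeightSpace K n M lam) :=
  ⟨fun d w => ⟨dnVal K n d • (w : M), genWS_stable K n M lam w.2 d⟩⟩

instance genWS_module (lam : Fin n → K) : Module (Dn K n) (genWeightSpace K n M lam) :=
  Module.ofMinimalAxioms
    (fun d x y => Subtype.ext (smul_add (dnVal K n d) (x : M) (y : M)))
    (fun d d' x => Subtype.ext (show dnVal K n (d + d') • (x : M)
      = dnVal K n d • (x : M) + dnVal K n d' • (x : M) by rw [map_add, add_smul]))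
    (fun d d' x => Subtype.ext (show dnVal K n (d * d') • (x : M)
      = dnVal K n d • (dnVal K n d' • (x : M)) by rw [map_mul, mul_smul]))
    (fun x => Subtype.ext (show dnVal K n 1 • (x : M) = (x : M) by rw [map_one, one_smul]))

instance genWS_tower (lam : Fin n → K) :
    IsScalarTower K (Dn K n) (genWeightSpace K n M lam) :=
  ⟨fun c d w => Subtype.ext (show dnVal K n (c • d) • (w : M) = c • (dnVal K n d • (w : M)) by
    rw [show dnVal K n (c • d) = c • dnVal K n d from map_smul (DnSub K n).val c d, smul_assoc])⟩

end DnModules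

/-- The maximal ideal `𝔪_λ = (H_1 − λ_1, …, H_n − λ_n)` of `D_n`. -/
def mIdeal (lam : Fin n → K) : Ideal (Dn K n) :=
  Ideal.span {d | ∃ i, d = HElD K n i - algebraMap K (Dn K n) (lam i)}

/-- The category `LF_𝔪(D_n)` of `𝔪_λ`-locally finite `D_n`-modules: every cyclic submodule is
finite dimensional over `K` and annihilated by a power of `𝔪_λ`. -/
def IsLF (lam : Fin n → K) (N : Type*) [AddCommGroup N] [Module K N] [Module (Dn K n) N]
    [IsScalarTower K (Dn K n) N] : Prop :=
  ∀ x : N, FiniteDimensional K ((Submodule.span (Dn K n) {x}).restrictScalars K) ∧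
    ∃ s : ℕ, ∀ i, ((HElD K n i - algebraMap K (Dn K n) (lam i)) ^ s) • x = 0

-- the algebra B_n = 𝕀_n/𝔞_n
/-- The maximal ideal `𝔞_n = 𝔭_1 + ⋯ + 𝔭_n` of `𝕀_n`. -/
def aFull : TwoSidedIdeal (In K n) := aIdeal K n Set.univ

/-- The skew Laurent polynomial algebra `B_n = 𝕀_n/𝔞_n`. -/
def Bn : Type _ := (aFull K n).ringCon.Quotient

instance : Ring (Bn K n) := inferInstanceAs (Ring (aFull K n).ringCon.Quotient)

/-- The quotient map `𝕀_n → B_n`. -/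
def toBn : In K n →+* Bn K n := RingCon.mk' _

lemma toBn_surjective : Function.Surjective (toBn K n) :=
  Quotient.mk''_surjective

/-- The composite `D_n → 𝕀_n → B_n`. -/
def bnD : Dn K n →+* Bn K n := (toBn K n).comp (dnVal K n)

/-- `B_n` as a right `D_n`-module (written as a left module structure, `d • b = b ⬝ d`). -/
instance : SMul (Dn K n) (Bn K n) := ⟨fun d b => b * bnD K n d⟩

instance : Module (Dn K n) (Bn K n) :=
  Module.ofMinimalAxioms
    (fun d x y => show (x + y) * bnD K n d = x * bnD K n d + y * bnD K n d from add_mul _ _ _)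
    (fun d d' x => show x * bnD K n (d + d') = x * bnD K n d + x * bnD K n d' by
      rw [map_add, mul_add])
    (fun d d' x => show x * bnD K n (d * d') = (x * bnD K n d') * bnD K n d by
      rw [mul_comm d d', map_mul, ← mul_assoc])
    (fun x => show x * bnD K n 1 = x by rw [map_one, mul_one])

instance : SMulCommClass (Dn K n) (Bn K n) (Bn K n) :=
  ⟨fun d b m => show (b * m) * bnD K n d = b * (m * bnD K n d) from mul_assoc b m (bnD K n d)⟩

/-- The induced module `B_n ⊗_{D_n} N` of a `D_n`-module `N`. -/
def Ind (N : Type*) [AddCommGroup N] [Module (Dn K n) N] : Type _ :=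
  (Bn K n) ⊗[Dn K n] N

section Ind

variable (N : Type*) [AddCommGroup N] [Module (Dn K n) N]

instance : AddCommGroup (Ind K n N) :=
  inferInstanceAs (AddCommGroup ((Bn K n) ⊗[Dn K n] N))

instance indModuleBn : Module (Bn K n) (Ind K n N) :=
  inferInstanceAs (Module (Bn K n) ((Bn K n) ⊗[Dn K n] N))

instance indModuleDn : Module (Dn K n) (Ind K n N) :=
  inferInstanceAs (Module (Dn K n) ((Bn K n) ⊗[Dn K n] N))

instance indModuleIn : Module (In K n) (Ind K n N) := Module.compHom _ (toBn K n)

instance indModuleK : Module K (Ind K n N) := Module.compHom _ (algebraMap K (Dn K n))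

lemma bn_algebraMap_comm (c : K) (u : Bn K n) :
    toBn K n (algebraMap K (In K n) c) * u = u * toBn K n (algebraMap K (In K n) c) := by
  obtain ⟨r, rfl⟩ := toBn_surjective K n u
  rw [← map_mul, ← map_mul, Algebra.commutes]

lemma dnVal_algebraMap (c : K) :
    dnVal K n (algebraMap K (Dn K n) c) = algebraMap K (In K n) c :=
  AlgHom.commutes (DnSub K n).val c

lemma ind_key (c : K) (w : (Bn K n) ⊗[Dn K n] N) :
    (toBn K n (algebraMap K (In K n) c)) • w = (algebraMap K (Dn K n) c) • w := by
  induction w using TensorProduct.induction_on with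
  | zero => rw [smul_zero, smul_zero]
  | tmul b x =>
      rw [TensorProduct.smul_tmul', TensorProduct.smul_tmul']
      congr 1
      show toBn K n (algebraMap K (In K n) c) * b = b * bnD K n (algebraMap K (Dn K n) c)
      have h1 : bnD K n (algebraMap K (Dn K n) c) = toBn K n (algebraMap K (In K n) c) := by
        show toBn K n (dnVal K n (algebraMap K (Dn K n) c)) = _
        rw [dnVal_algebraMap]
      rw [h1, bn_algebraMap_comm]
  | add x y hx hy => rw [smul_add, smul_add, hx, hy]

instance indTower : IsScalarTower K (In K n) (Ind K n N) := by
  constructor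
  intro c a v
  show toBn K n (c • a) • v = algebraMap K (Dn K n) c • ((toBn K n a : Bn K n) • v)
  rw [Algebra.smul_def, map_mul, mul_smul]
  exact ind_key K n N c _

end Ind


section BnQuot

variable (J : Submodule (Bn K n) (Bn K n))

instance : Module (In K n) (Bn K n ⧸ J) := Module.compHom _ (toBn K n)

instance : Module K (Bn K n ⧸ J) :=
  Module.compHom _ ((toBn K n).comp (algebraMap K (In K n)))

instance : IsScalarTower K (In K n) (Bn K n ⧸ J) := by
  constructor
  intro c a v
  show toBn K n (c • a) • v = (toBn K n (algebraMap K (In K n) c)) • (toBn K n a • v)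
  rw [Algebra.smul_def, map_mul, mul_smul]

end BnQuot

/-- The `𝕀_n`-module `M` "is" the tensor product `A ⊗ B` of an `𝕀_m`-module `A` and an
`𝕀_{n-m}`-module `B`: there is a `K`-linear isomorphism under which the generators of `𝕀_n`
with index `< m` act on the first factor (via the corresponding generators of `𝕀_m`) and the
remaining generators act on the second factor (via the generators of `𝕀_{n-m}`). -/
def RealizesSplit (m : ℕ) (A : Type*) [AddCommGroup A] [Module K A] [Module (In K m) A]
    [IsScalarTower K (In K m) A]
    (B : Type*) [AddCommGroup B] [Module K B] [Module (In K (n - m)) B]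
    [IsScalarTower K (In K (n - m)) B]
    (M : Type*) [AddCommGroup M] [Module K M] [Module (In K n) M]
    [IsScalarTower K (In K n) M] : Prop :=
  ∃ φ : M ≃ₗ[K] A ⊗[K] B,
    (∀ (i : Fin n) (hi : (i : ℕ) < m) (v : M),
      φ (xEl K n i • v) = LinearMap.rTensor B
        (DistribMulAction.toLinearMap K A (xEl K m ⟨i, hi⟩)) (φ v) ∧
      φ (dEl K n i • v) = LinearMap.rTensor B
        (DistribMulAction.toLinearMap K A (dEl K m ⟨i, hi⟩)) (φ v) ∧
      φ (intEl K n i • v) = LinearMap.rTensor B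
        (DistribMulAction.toLinearMap K A (intEl K m ⟨i, hi⟩)) (φ v)) ∧
    (∀ (i : Fin n) (hi : m ≤ (i : ℕ)) (v : M),
      φ (xEl K n i • v) = LinearMap.lTensor A
        (DistribMulAction.toLinearMap K B (xEl K (n - m) ⟨(i : ℕ) - m, by omega⟩)) (φ v) ∧
      φ (dEl K n i • v) = LinearMap.lTensor A
        (DistribMulAction.toLinearMap K B (dEl K (n - m) ⟨(i : ℕ) - m, by omega⟩)) (φ v) ∧
      φ (intEl K n i • v) = LinearMap.lTensor A
        (DistribMulAction.toLinearMap K B (intEl K (n - m) ⟨(i : ℕ) - m, by omega⟩)) (φ v))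

end


section Aux1

theorem In_ext' {K : Type*} [Field K] [CharZero K] {n : ℕ} {a b : In K n}
    (h : ∀ p : P K n, a • p = b • p) : a = b := by
  have : (show InSub K n from a) = (show InSub K n from b) :=
    Subtype.ext (LinearMap.ext fun p => h p)
  exact this

theorem In_induction {K : Type*} [Field K] [CharZero K] {n : ℕ} {p : In K n → Prop}
    (hc : ∀ c : K, p (algebraMap K (In K n) c))
    (hx : ∀ i, p (xEl K n i)) (hd : ∀ i, p (dEl K n i)) (hs : ∀ i, p (intEl K n i))
    (hadd : ∀ a b, p a → p b → p (a + b)) (hmul : ∀ a b, p a → p b → p (a * b))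
    (a : In K n) : p a := by
  obtain ⟨y, hy⟩ := a
  refine Algebra.adjoin_induction
    (p := fun y hy => p (show InSub K n from ⟨y, hy⟩)) ?_ hc ?_ ?_ hy
  · rintro _ ((⟨i, rfl⟩ | ⟨i, rfl⟩) | ⟨i, rfl⟩)
    · exact hx i
    · exact hd i
    · exact hs i
  · intro x y hx hy h1 h2
    exact hadd _ _ h1 h2
  · intro x y hx hy h1 h2
    exact hmul _ _ h1 h2

theorem exists_simple_subfactor {R M : Type*} [Ring R] [AddCommGroup M] [Module R M]
    (p : Submodule R M) (v : M) (hv : v ∉ p) :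
    ∃ p' : Submodule R M, p ≤ p' ∧ p' ≤ p ⊔ Submodule.span R {v} ∧ v ∉ p' ∧
      IsSimpleModule R (↥(p ⊔ Submodule.span R {v}) ⧸
        Submodule.comap (p ⊔ Submodule.span R {v}).subtype p') := by
  set q := p ⊔ Submodule.span R {v} with hq
  have hvq : v ∈ q := Submodule.mem_sup_right (Submodule.mem_span_singleton_self v)
  obtain ⟨m, hpm, hmax⟩ := zorn_le_nonempty₀
    {p' : Submodule R M | p ≤ p' ∧ p' ≤ q ∧ v ∉ p'} (by
      intro c hc hchain y hy
      refine ⟨sSup c, ⟨(hc hy).1.trans (le_sSup hy), sSup_le fun z hz => (hc hz).2.1, ?_⟩,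
        fun z hz => le_sSup hz⟩
      rw [Submodule.mem_sSup_of_directed ⟨y, hy⟩ hchain.directedOn]
      rintro ⟨z, hz, hvz⟩
      exact (hc hz).2.2 hvz) p ⟨le_rfl, le_sup_left, hv⟩
  obtain ⟨⟨h1, h2, h3⟩, h4⟩ := hmax
  refine ⟨m, h1, h2, h3, ?_⟩
  rw [← covBy_iff_quot_is_simple h2]
  refine ⟨lt_of_le_of_ne h2 (fun h => h3 (h ▸ hvq)), fun z hz hzq => ?_⟩
  by_cases hvz : v ∈ z
  · apply hzq.not_ge
    rw [hq]
    exact sup_le (h1.trans hz.le) ((Submodule.span_singleton_le_iff_mem v z).2 hvz)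
  · exact hz.not_ge (h4 ⟨h1.trans hz.le, hzq.le, hvz⟩ hz.le)

end Aux1

section Aux2

variable {K : Type*} [Field K] [CharZero K] {n : ℕ}
variable {M : Type*} [AddCommGroup M] [Module K M] [Module (In K n) M]
  [IsScalarTower K (In K n) M]

theorem genWS_indep : iSupIndep (fun lam : Fin n → K => genWeightSpace K n M lam) := by
  let f : Fin n → Module.End K M := fun i => DistribMulAction.toLinearMap K M (HEl K n i)
  have hcomm : ∀ i j, Commute (f i) (f j) := by
    intro i j
    apply LinearMap.ext
    intro m
    show HEl K n i • HEl K n j • m = HEl K n j • HEl K n i • m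
    rw [← mul_smul, hEl_comm, mul_smul]
  have hind := Module.End.independent_iInf_maxGenEigenspace_of_forall_mapsTo f
    (fun i j φ => Module.End.mapsTo_maxGenEigenspace_of_comm (hcomm j i) φ)
  refine hind.mono ?_
  intro lam m hm
  obtain ⟨N, hN⟩ := hm
  rw [Submodule.mem_iInf]
  intro i
  rw [Module.End.mem_maxGenEigenspace]
  refine ⟨N, ?_⟩
  have key : ∀ (N : ℕ), ((f i - lam i • (1 : Module.End K M)) ^ N) m
      = ((HEl K n i - algebraMap K (In K n) (lam i)) ^ N) • m := by
    intro N
    induction N with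
    | zero => simp
    | succ N ih =>
      rw [pow_succ', pow_succ', mul_smul, Module.End.mul_apply, ih, sub_smul]
      rw [algebraMap_smul]
      rfl
  rw [key, hN]

theorem weight_mem {w : M} {lam : Fin n → K} (h : ∀ i, HEl K n i • w = lam i • w) :
    w ∈ genWeightSpace K n M lam := by
  refine ⟨1, fun i => ?_⟩
  rw [pow_one, sub_smul, algebraMap_smul, h, sub_self]

end Aux2

section Aux3

variable {K : Type*} [Field K] [CharZero K] {n : ℕ}

theorem In_smul_K {M : Type*} [AddCommGroup M] [Module K M] [Module (In K n) M]
    [IsScalarTower K (In K n) M] (a : In K n) (c : K) (m : M) : a • c • m = c • a • m :=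
  (smul_comm c a m).symm

/-- normalized monomial coefficient -/
noncomputable def cP (K : Type*) [Field K] {n : ℕ} (α : Fin n →₀ ℕ) : K :=
  (∏ j, ((α j).factorial : K))⁻¹

theorem cP_ne (α : Fin n →₀ ℕ) : cP K α ≠ 0 := by
  unfold cP
  refine inv_ne_zero (Finset.prod_ne_zero_iff.2 fun j _ => ?_)
  exact_mod_cast (Nat.factorial_ne_zero _)

theorem cP_succ (α : Fin n →₀ ℕ) (i : Fin n) :
    cP K α = ((α i : K) + 1) * cP K (α + Finsupp.single i 1) := by
  have h : (∏ j, ((((α + Finsupp.single i 1 : Fin n →₀ ℕ)) j).factorial : K))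
      = ((α i : K) + 1) * ∏ j, ((α j).factorial : K) := by
    rw [← Finset.mul_prod_erase Finset.univ (fun j => ((((α + Finsupp.single i 1 : Fin n →₀ ℕ)) j).factorial : K))
      (Finset.mem_univ i), ← Finset.mul_prod_erase Finset.univ (fun j => ((α j).factorial : K))
      (Finset.mem_univ i), ← mul_assoc]
    congr 1
    · simp [Nat.factorial_succ]
    · refine Finset.prod_congr rfl fun j hj => ?_
      have : j ≠ i := Finset.ne_of_mem_erase hj
      simp [Finsupp.single_apply, this.symm]
  have h1 : (α i : K) + 1 ≠ 0 := by exact_mod_cast Nat.succ_ne_zero (α i)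
  unfold cP
  rw [h, mul_inv, ← mul_assoc, mul_inv_cancel₀ h1, one_mul]

/-- normalized monomial -/
noncomputable def mP (K : Type*) [Field K] {n : ℕ} (α : Fin n →₀ ℕ) : P K n :=
  MvPolynomial.monomial α (cP K α)

theorem mP_ne (α : Fin n →₀ ℕ) : mP K α ≠ 0 := by
  unfold mP
  rw [Ne, MvPolynomial.monomial_eq_zero]
  exact cP_ne α

theorem mP_d_succ (α : Fin n →₀ ℕ) (i : Fin n) :
    dEl K n i • mP K (α + Finsupp.single i 1) = mP K α := by
  rw [dEl_smul, mP, MvPolynomial.pderiv_monomial, add_tsub_cancel_right, mP, cP_succ α i]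
  congr 1
  simp [mul_comm]

theorem mP_d_zero (α : Fin n →₀ ℕ) (i : Fin n) (h : α i = 0) :
    dEl K n i • mP K α = 0 := by
  rw [dEl_smul, mP, MvPolynomial.pderiv_monomial, h]
  simp

theorem mP_x (α : Fin n →₀ ℕ) (i : Fin n) :
    xEl K n i • mP K α = ((α i : K) + 1) • mP K (α + Finsupp.single i 1) := by
  rw [xEl_smul, mP, MvPolynomial.X, MvPolynomial.monomial_mul, one_mul, add_comm, mP,
    MvPolynomial.smul_monomial, cP_succ α i, smul_eq_mul]

theorem mP_s (α : Fin n →₀ ℕ) (i : Fin n) :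
    intEl K n i • mP K α = mP K (α + Finsupp.single i 1) := by
  have h0 : mP K α = cP K α • MvPolynomial.basisMonomials (Fin n) K α := by
    rw [mP, MvPolynomial.coe_basisMonomials, MvPolynomial.smul_monomial, smul_eq_mul, mul_one]
  have h1 : (α i : K) + 1 ≠ 0 := by exact_mod_cast Nat.succ_ne_zero (α i)
  show intOp K n i (mP K α) = _
  rw [h0, map_smul, intOp, Module.Basis.constr_basis, mP, MvPolynomial.smul_monomial,
    MvPolynomial.smul_monomial, cP_succ α i]
  congr 1
  simp only [smul_eq_mul]
  field_simp

open Classical in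
/-- normalized monomials indexed by all of `ℤ^n` -/
noncomputable def wP (K : Type*) [Field K] {n : ℕ} (k : Fin n → ℤ) : P K n :=
  if ∀ i, 0 ≤ k i then mP K (Finsupp.equivFunOnFinite.symm (fun i => (k i).toNat)) else 0

theorem wP_nat (α : Fin n →₀ ℕ) : wP K (fun i => (α i : ℤ)) = mP K α := by
  unfold wP
  rw [if_pos (fun i => Int.natCast_nonneg _)]
  congr 1
  ext i
  simp

theorem wP_neg {k : Fin n → ℤ} (i : Fin n) (h : k i < 0) : wP K k = 0 := by
  unfold wP
  rw [if_neg]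
  push Not
  exact ⟨i, h⟩

theorem exists_nat {k : Fin n → ℤ} (h : ∀ i, 0 ≤ k i) :
    ∃ α : Fin n →₀ ℕ, k = fun i => (α i : ℤ) :=
  ⟨Finsupp.equivFunOnFinite.symm (fun i => (k i).toNat), by
    funext i; simp [h i]⟩

theorem add_single_nat (α : Fin n →₀ ℕ) (i : Fin n) :
    (fun j => (α j : ℤ)) + Pi.single i 1 = fun j => (((α + Finsupp.single i 1 : Fin n →₀ ℕ)) j : ℤ) := by
  funext j
  by_cases hj : j = i
  · subst hj; simp
  · simp [hj, Finsupp.single_apply, Ne.symm hj]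

theorem wP_x (i : Fin n) (k : Fin n → ℤ) :
    xEl K n i • wP K k = ((k i : K) + 1) • wP K (k + Pi.single i 1) := by
  by_cases h : ∀ j, 0 ≤ k j
  · obtain ⟨α, rfl⟩ := exists_nat h
    rw [add_single_nat, wP_nat, wP_nat, mP_x]
    simp
  · push Not at h
    obtain ⟨j, hj⟩ := h
    rw [wP_neg (K := K) j hj, smul_zero]
    by_cases hji : j = i
    · subst hji
      by_cases h1 : k j = -1
      · simp [h1]
      · rw [wP_neg (K := K) j (by simp; omega), smul_zero]
    · rw [wP_neg (K := K) j (by simpa [hji] using hj), smul_zero]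

theorem wP_s (i : Fin n) (k : Fin n → ℤ) (hk : k i ≠ -1) :
    intEl K n i • wP K k = wP K (k + Pi.single i 1) := by
  by_cases h : ∀ j, 0 ≤ k j
  · obtain ⟨α, rfl⟩ := exists_nat h
    rw [add_single_nat, wP_nat, wP_nat, mP_s]
  · push Not at h
    obtain ⟨j, hj⟩ := h
    rw [wP_neg (K := K) j hj, smul_zero]
    by_cases hji : j = i
    · subst hji
      rw [wP_neg (K := K) j (by simp; omega)]
    · rw [wP_neg (K := K) j (by simpa [hji] using hj)]

theorem wP_d (i : Fin n) (k : Fin n → ℤ) :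
    dEl K n i • wP K k = wP K (k - Pi.single i 1) := by
  by_cases h : ∀ j, 0 ≤ k j
  · by_cases hi : k i = 0
    · rw [wP_neg (k := k - Pi.single i 1) i (by simp [hi])]
      obtain ⟨α, rfl⟩ := exists_nat h
      rw [wP_nat]
      exact mP_d_zero α i (by simpa using hi)
    · have h' : ∀ j, 0 ≤ ((k - Pi.single i 1 : Fin n → ℤ)) j := by
        intro j
        by_cases hji : j = i
        · subst hji
          have := h j
          simp; omega
        · simpa [hji] using h j
      obtain ⟨α, hα⟩ := exists_nat h'
      have : k = (fun j => (α j : ℤ)) + Pi.single i 1 := by rw [← hα]; simp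
      rw [hα, this, add_single_nat, wP_nat, wP_nat, mP_d_succ]
  · push Not at h
    obtain ⟨j, hj⟩ := h
    rw [wP_neg (K := K) j hj, smul_zero]
    by_cases hji : j = i
    · subst hji
      rw [wP_neg (K := K) j (by simp; omega)]
    · rw [wP_neg (K := K) j (by simpa [hji] using hj)]

theorem wP_ne {k : Fin n → ℤ} (h : ∀ j, 0 ≤ k j) : wP K k ≠ 0 := by
  obtain ⟨α, rfl⟩ := exists_nat h
  rw [wP_nat]
  exact mP_ne α

theorem In_ext_w {a b : In K n}
    (h : ∀ k : Fin n → ℤ, (∀ i, 0 ≤ k i) → a • wP K k = b • wP K k) : a = b := by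
  apply In_ext'
  intro p
  induction p using MvPolynomial.induction_on' with
  | monomial α c =>
    have hm : (MvPolynomial.monomial α c : P K n)
        = (c * (cP K α)⁻¹) • wP K (fun i => (α i : ℤ)) := by
      rw [wP_nat, mP, MvPolynomial.smul_monomial, smul_eq_mul, mul_assoc,
        inv_mul_cancel₀ (cP_ne α), mul_one]
    rw [hm, In_smul_K, In_smul_K, h _ (fun i => Int.natCast_nonneg _)]
  | add p q hp hq => rw [smul_add, smul_add, hp, hq]

theorem d_mul_s (i : Fin n) : dEl K n i * intEl K n i = 1 := by
  apply In_ext_w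
  intro k hk
  rw [mul_smul, wP_s _ _ (by have := hk i; omega), wP_d, one_smul, add_sub_cancel_right]

theorem s_mul_d_mul_x (i : Fin n) : intEl K n i * (dEl K n i * xEl K n i) = xEl K n i := by
  apply In_ext_w
  intro k hk
  rw [mul_smul, mul_smul, wP_x, In_smul_K, wP_d, In_smul_K, add_sub_cancel_right,
    wP_s _ _ (by have := hk i; omega)]

theorem d_mul_x (i : Fin n) : dEl K n i * xEl K n i = xEl K n i * dEl K n i + 1 := by
  apply In_ext_w
  intro k hk
  rw [mul_smul, add_smul, mul_smul, wP_x, wP_d, In_smul_K, wP_d, wP_x, one_smul,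
    add_sub_cancel_right, sub_add_cancel]
  simp [add_smul]

end Aux3

section Aux4

variable {K : Type*} [Field K] [CharZero K] {n : ℕ}

open Classical in
/-- A `ℤ^n`-indexed family in an `𝕀_n`-module on which the generators act in a standard way. -/
structure Dat (D : Set (Fin n)) {W : Type*} [AddCommGroup W] [Module K W] [Module (In K n) W]
    (w : (Fin n → ℤ) → W) (mu : Fin n → K) (m : ℤ) : Prop where
  d : ∀ i k, dEl K n i • w k = w (k - Pi.single i 1)
  x : ∀ i k, xEl K n i • w k
    = ((if i ∈ D then 0 else mu i) + (k i : K) + 1) • w (k + Pi.single i 1)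
  s : ∀ i k, (∀ j, j ∉ D → m ≤ k j) →
    intEl K n i • w k = if i ∈ D ∧ k i = -1 then 0 else w (k + Pi.single i 1)

theorem Dat.mono {D : Set (Fin n)} {W : Type*} [AddCommGroup W] [Module K W] [Module (In K n) W]
    {w : (Fin n → ℤ) → W} {mu : Fin n → K} {m m' : ℤ} (h : Dat D w mu m) (hm : m ≤ m') :
    Dat D w mu m' :=
  ⟨h.d, h.x, fun i k hk => h.s i k fun j hj => hm.trans (hk j hj)⟩

/-- generic module -/
abbrev GG (K : Type*) [Field K] (n : ℕ) : Type _ := (Fin n → ℤ) →₀ P K n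

/-- specialization of the generic module -/
noncomputable def evG {W : Type*} [AddCommGroup W] [Module K W]
    (w : (Fin n → ℤ) → W) (mu : Fin n → K) : GG K n →+ W :=
  Finsupp.liftAddHom (fun k => ((smulAddHom K W).flip (w k)).comp
    (MvPolynomial.eval mu).toAddMonoidHom)

section
variable {W : Type*} [AddCommGroup W] [Module K W]
    (w : (Fin n → ℤ) → W) (mu : Fin n → K)

theorem evG_single (k : Fin n → ℤ) (p : P K n) :
    evG w mu (Finsupp.single k p) = MvPolynomial.eval mu p • w k := by
  simp [evG]

theorem evG_apply (g : GG K n) :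
    evG w mu g = ∑ k ∈ g.support, MvPolynomial.eval mu (g k) • w k := by
  simp [evG, Finsupp.sum]

theorem evG_smul (p : P K n) (g : GG K n) :
    evG w mu (p • g) = MvPolynomial.eval mu p • evG w mu g := by
  induction g using Finsupp.induction_linear with
  | zero => simp
  | add f g hf hg => rw [smul_add, map_add, map_add, hf, hg, smul_add]
  | single k q => rw [Finsupp.smul_single, evG_single, evG_single, smul_eq_mul, map_mul, mul_smul]

end

/-- region -/
noncomputable def RG (K : Type*) [Field K] {n : ℕ} (D : Set (Fin n)) (m : ℤ) :
    Submodule (P K n) (GG K n) :=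
  Submodule.span (P K n) ((fun k => Finsupp.single k 1) '' {k | ∀ j, j ∉ D → m ≤ k j})

theorem RG_mono (D : Set (Fin n)) {m m' : ℤ} (h : m' ≤ m) : RG K D m ≤ RG K D m' :=
  Submodule.span_mono (Set.image_mono fun _ hk j hj => h.trans (hk j hj))

/-- `L` models `a` on the standard families in `W`. -/
def Compat (D : Set (Fin n)) (W : Type*) [AddCommGroup W] [Module K W] [Module (In K n) W]
    (N : ℕ) (L : GG K n →ₗ[P K n] GG K n) (a : In K n) : Prop :=
  ∀ (w : (Fin n → ℤ) → W) (mu : Fin n → K) (m : ℤ), Dat D w mu (m - N) → ∀ g ∈ RG K D m,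
    a • evG w mu g = evG w mu (L g)

theorem compat_of_gen (D : Set (Fin n)) (W : Type*) [AddCommGroup W] [Module K W]
    [Module (In K n) W] [IsScalarTower K (In K n) W]
    (N : ℕ) (f : (Fin n → ℤ) → GG K n) (a : In K n)
    (h : ∀ (w : (Fin n → ℤ) → W) (mu : Fin n → K) (m : ℤ), Dat D w mu (m - N) →
      ∀ k, (∀ j, j ∉ D → m ≤ k j) → a • w k = evG w mu (f k)) :
    Compat D W N (Finsupp.linearCombination (P K n) f) a := by
  intro w mu m hd g hg
  induction hg using Submodule.span_induction with
  | mem g hg =>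
    obtain ⟨k, hk, rfl⟩ := hg
    simp only [evG_single, map_one, one_smul, Finsupp.linearCombination_single]
    exact h w mu m hd k hk
  | zero => simp
  | add f g _ _ hf hg => rw [map_add, smul_add, hf, hg, map_add, map_add]
  | smul p g _ hg => rw [evG_smul, In_smul_K, hg, map_smul, evG_smul]

theorem shift_of_gen (D : Set (Fin n)) (N : ℕ) (f : (Fin n → ℤ) → GG K n)
    (h : ∀ m k, (∀ j, j ∉ D → m ≤ k j) → f k ∈ RG K D (m - N)) (m : ℤ) (g : GG K n)
    (hg : g ∈ RG K D m) : Finsupp.linearCombination (P K n) f g ∈ RG K D (m - N) := by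
  induction hg using Submodule.span_induction with
  | mem g hg =>
    obtain ⟨k, hk, rfl⟩ := hg
    simp only [Finsupp.linearCombination_single, one_smul]
    exact h m k hk
  | zero => simp
  | add f g _ _ hf hg => rw [map_add]; exact add_mem hf hg
  | smul p g _ hg => rw [map_smul]; exact Submodule.smul_mem _ _ hg

/-- every operator has a generic model -/
def Good (D : Set (Fin n)) (W₁ : Type*) [AddCommGroup W₁] [Module K W₁] [Module (In K n) W₁]
    (W₂ : Type*) [AddCommGroup W₂] [Module K W₂] [Module (In K n) W₂] (a : In K n) : Prop :=
  ∃ (N : ℕ) (L : GG K n →ₗ[P K n] GG K n),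
    (∀ m, ∀ g ∈ RG K D m, L g ∈ RG K D (m - N)) ∧ Compat D W₁ N L a ∧ Compat D W₂ N L a

theorem single_mem_RG {D : Set (Fin n)} {m : ℤ} {k : Fin n → ℤ} (h : ∀ j, j ∉ D → m ≤ k j)
    (p : P K n) : Finsupp.single k p ∈ RG K D m := by
  have : (Finsupp.single k p : GG K n) = p • Finsupp.single k 1 := by simp
  rw [this]
  exact Submodule.smul_mem _ _ (Submodule.subset_span ⟨k, h, rfl⟩)

section
variable (D : Set (Fin n)) (W₁ : Type*) [AddCommGroup W₁] [Module K W₁] [Module (In K n) W₁]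
    [IsScalarTower K (In K n) W₁]
    (W₂ : Type*) [AddCommGroup W₂] [Module K W₂] [Module (In K n) W₂]
    [IsScalarTower K (In K n) W₂]

theorem good_of_gen (f : (Fin n → ℤ) → GG K n) (a : In K n)
    (h0 : ∀ m k, (∀ j, j ∉ D → m ≤ k j) → f k ∈ RG K D (m - 1))
    (h1 : ∀ (w : (Fin n → ℤ) → W₁) (mu : Fin n → K) (m : ℤ), Dat D w mu (m - 1) →
      ∀ k, (∀ j, j ∉ D → m ≤ k j) → a • w k = evG w mu (f k))
    (h2 : ∀ (w : (Fin n → ℤ) → W₂) (mu : Fin n → K) (m : ℤ), Dat D w mu (m - 1) →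
      ∀ k, (∀ j, j ∉ D → m ≤ k j) → a • w k = evG w mu (f k)) : Good D W₁ W₂ a :=
  ⟨1, _, shift_of_gen D 1 f (by simpa using h0), compat_of_gen D W₁ 1 f a (by simpa using h1),
    compat_of_gen D W₂ 1 f a (by simpa using h2)⟩

theorem le_pred_add {m : ℤ} {k : Fin n → ℤ} {D : Set (Fin n)} (h : ∀ j, j ∉ D → m ≤ k j)
    (i : Fin n) : ∀ j, j ∉ D → m - 1 ≤ ((k + Pi.single i 1 : Fin n → ℤ)) j := by
  intro j hj
  have := h j hj
  by_cases hji : j = i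
  · subst hji; simp; omega
  · simp [hji]; omega

theorem le_pred_sub {m : ℤ} {k : Fin n → ℤ} {D : Set (Fin n)} (h : ∀ j, j ∉ D → m ≤ k j)
    (i : Fin n) : ∀ j, j ∉ D → m - 1 ≤ ((k - Pi.single i 1 : Fin n → ℤ)) j := by
  intro j hj
  have := h j hj
  by_cases hji : j = i
  · subst hji; simp; omega
  · simp [hji]; omega

open Classical in
theorem good_all (a : In K n) : Good D W₁ W₂ a := by
  induction a using In_induction with
  | hc c =>
    refine ⟨0, (MvPolynomial.C c : P K n) • (LinearMap.id : GG K n →ₗ[P K n] GG K n), ?_, ?_, ?_⟩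
    · intro m g hg
      have := Submodule.smul_mem (RG K D m) (MvPolynomial.C c : P K n) hg
      simpa using this
    · intro w mu m _ g hg
      simp [evG_smul, algebraMap_smul]
    · intro w mu m _ g hg
      simp [evG_smul, algebraMap_smul]
  | hx i =>
    refine good_of_gen D W₁ W₂ (fun k => Finsupp.single (k + Pi.single i 1)
      ((if i ∈ D then 0 else MvPolynomial.X i) + MvPolynomial.C (k i : K) + 1)) _ ?_ ?_ ?_
    · intro m k hk
      exact single_mem_RG (le_pred_add hk i) _
    all_goals
      intro w mu m hd k hk
      rw [hd.x, evG_single]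
      congr 1
      split_ifs <;> simp
  | hd i =>
    refine good_of_gen D W₁ W₂ (fun k => Finsupp.single (k - Pi.single i 1) 1) _ ?_ ?_ ?_
    · intro m k hk
      exact single_mem_RG (le_pred_sub hk i) _
    all_goals
      intro w mu m hd k hk
      rw [hd.d, evG_single]
      simp
  | hs i =>
    refine good_of_gen D W₁ W₂ (fun k => if i ∈ D ∧ k i = -1 then 0 else
      Finsupp.single (k + Pi.single i 1) 1) _ ?_ ?_ ?_
    · intro m k hk
      split_ifs
      · exact zero_mem _
      · exact single_mem_RG (le_pred_add hk i) _
    all_goals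
      intro w mu m hd k hk
      rw [hd.s _ _ (fun j hj => by have := hk j hj; omega)]
      split_ifs
      · simp
      · simp [evG_single]
  | hadd a b ha hb =>
    obtain ⟨N, L, h0, h1, h2⟩ := ha
    obtain ⟨N', L', h0', h1', h2'⟩ := hb
    refine ⟨N + N', L + L', ?_, ?_, ?_⟩
    · intro m g hg
      exact add_mem (RG_mono D (by push_cast; omega) (h0 m g hg))
        (RG_mono D (by push_cast; omega) (h0' m g hg))
    · intro w mu m hd g hg
      rw [add_smul, h1 w mu m (hd.mono (by push_cast; omega)) g hg,
        h1' w mu m (hd.mono (by push_cast; omega)) g hg, LinearMap.add_apply, map_add]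
    · intro w mu m hd g hg
      rw [add_smul, h2 w mu m (hd.mono (by push_cast; omega)) g hg,
        h2' w mu m (hd.mono (by push_cast; omega)) g hg, LinearMap.add_apply, map_add]
  | hmul a b ha hb =>
    obtain ⟨N, L, h0, h1, h2⟩ := ha
    obtain ⟨N', L', h0', h1', h2'⟩ := hb
    refine ⟨N + N', L ∘ₗ L', ?_, ?_, ?_⟩
    · intro m g hg
      have := h0 _ _ (h0' m g hg)
      exact RG_mono D (by push_cast; omega) this
    · intro w mu m hd g hg
      rw [mul_smul, h1' w mu m (hd.mono (by push_cast; omega)) g hg,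
        h1 w mu _ (hd.mono (by push_cast; omega)) _ (h0' m g hg), LinearMap.comp_apply]
    · intro w mu m hd g hg
      rw [mul_smul, h2' w mu m (hd.mono (by push_cast; omega)) g hg,
        h2 w mu _ (hd.mono (by push_cast; omega)) _ (h0' m g hg), LinearMap.comp_apply]

end

end Aux4

section Aux5

variable {K : Type*} [Field K] [CharZero K] {n : ℕ}

theorem dat_shift {D : Set (Fin n)} {W : Type*} [AddCommGroup W] [Module K W] [Module (In K n) W]
    {w : (Fin n → ℤ) → W} {mu : Fin n → K} (h : ∀ m, Dat D w mu m) (z : Fin n → ℤ)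
    (hz : ∀ i ∈ D, z i = 0) (mu' : Fin n → K) (hmu : ∀ i, i ∉ D → mu' i = mu i + z i) (m : ℤ) :
    Dat D (fun k => w (k + z)) mu' m := by
  refine ⟨fun i k => ?_, fun i k => ?_, fun i k hk => ?_⟩
  · rw [(h 0).d]
    congr 1
    abel
  · rw [(h 0).x, add_right_comm k]
    congr 1
    by_cases hi : i ∈ D
    · simp [hi, hz i hi]
    · simp [hi, hmu i hi]; ring
  · obtain ⟨c, hc⟩ : ∃ c : ℤ, ∀ j, c ≤ z j := by
      have := (Set.finite_range z).bddBelow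
      obtain ⟨c, hc⟩ := this
      exact ⟨c, fun j => hc ⟨j, rfl⟩⟩
    rw [(h (m + c)).s i (k + z) (fun j hj => by
      have := hk j hj; have := hc j; simp; omega), add_right_comm k]
    by_cases hi : i ∈ D
    · simp [hi, hz i hi]
    · simp [hi]

theorem dat_P (D : Set (Fin n)) (z : Fin n → ℤ) (hz : ∀ i ∈ D, z i = 0) (m : ℤ)
    (hm : ∀ i, i ∉ D → 0 ≤ m + z i) :
    Dat D (fun k => wP K (k + z)) (fun i => (z i : K)) m := by
  refine ⟨fun i k => ?_, fun i k => ?_, fun i k hk => ?_⟩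
  · rw [wP_d]
    congr 1
    abel
  · rw [wP_x, add_right_comm k]
    congr 1
    by_cases hi : i ∈ D
    · simp [hi, hz i hi]
    · simp [hi]; ring
  · by_cases hi : i ∈ D
    · by_cases hk1 : k i = -1
      · rw [if_pos ⟨hi, hk1⟩, wP_neg (K := K) i (by simp [hk1, hz i hi]), smul_zero]
      · rw [if_neg (by tauto), wP_s _ _ (by simpa [hz i hi] using hk1), add_right_comm k]
    · rw [if_neg (by tauto), wP_s _ _ (by have := hk i hi; have := hm i hi; simp; omega),
        add_right_comm k]

theorem e_mem_aIdeal {I : Set (Fin n)} {i : Fin n} (hi : i ∈ I) (s t : ℕ) :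
    eElN K n i s t ∈ aIdeal K n I := by
  have h1 : pIdeal K n i ≤ aIdeal K n I := le_iSup₂_of_le i hi le_rfl
  exact h1 (TwoSidedIdeal.subset_span ⟨s, t, rfl⟩)

theorem one_sub_mem_aIdeal {I : Set (Fin n)} {i : Fin n} (hi : i ∈ I) (N : ℕ) :
    1 - intEl K n i ^ N * dEl K n i ^ N ∈ aIdeal K n I := by
  have : 1 - intEl K n i ^ N * dEl K n i ^ N = ∑ s ∈ Finset.range N, eElN K n i s s := by
    unfold eElN
    rw [Finset.sum_range_sub' (fun s => intEl K n i ^ s * dEl K n i ^ s)]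
    simp
  rw [this]
  exact TwoSidedIdeal.finsetSum_mem _ _ _ (fun s _ => e_mem_aIdeal hi s s)

theorem wP_d_pow (i : Fin n) (N : ℕ) (k : Fin n → ℤ) :
    dEl K n i ^ N • wP K k = wP K (k - Pi.single i (N : ℤ)) := by
  induction N with
  | zero => simp
  | succ N ih =>
    rw [pow_succ', mul_smul, ih, wP_d]
    congr 1
    push_cast
    rw [Pi.single_add]; abel

theorem wP_s_pow (i : Fin n) (N : ℕ) (k : Fin n → ℤ) (hk : 0 ≤ k i) :
    intEl K n i ^ N • wP K k = wP K (k + Pi.single i (N : ℤ)) := by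
  induction N with
  | zero => simp
  | succ N ih =>
    rw [pow_succ', mul_smul, ih, wP_s _ _ (by simp; omega)]
    congr 1
    push_cast
    rw [Pi.single_add]; abel

theorem mem_aIdeal_of_kill (I : Set (Fin n)) (N : ℕ) (s : Finset (Fin n)) (hs : ∀ i ∈ s, i ∈ I) :
    ∀ a : In K n, (∀ k : Fin n → ℤ, (∀ i ∈ s, (N : ℤ) ≤ k i) → a • wP K k = 0) →
      a ∈ aIdeal K n I := by
  classical
  induction s using Finset.induction_on with
  | empty =>
    intro a ha
    have : a = 0 := In_ext_w fun k _ => by rw [ha k (by simp), zero_smul]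
    rw [this]
    exact zero_mem _
  | insert i s his ih =>
    intro a ha
    have h1 : a * (intEl K n i ^ N * dEl K n i ^ N) ∈ aIdeal K n I := by
      refine ih (fun j hj => hs j (Finset.mem_insert_of_mem hj)) _ fun k hk => ?_
      rw [mul_smul, mul_smul, wP_d_pow]
      by_cases hki : (N : ℤ) ≤ k i
      · rw [wP_s_pow _ _ _ (by simpa using hki), sub_add_cancel]
        refine ha k fun j hj => ?_
        rcases Finset.mem_insert.1 hj with rfl | hj
        · exact hki
        · exact hk j hj
      · rw [wP_neg (K := K) i (by simp; omega), smul_zero, smul_zero]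
    have h2 : a * (1 - intEl K n i ^ N * dEl K n i ^ N) ∈ aIdeal K n I :=
      TwoSidedIdeal.mul_mem_left _ _ _ (one_sub_mem_aIdeal (hs i (Finset.mem_insert_self _ _)) N)
    have h3 : a = a * (1 - intEl K n i ^ N * dEl K n i ^ N)
        + a * (intEl K n i ^ N * dEl K n i ^ N) := by rw [← mul_add]; simp
    rw [h3]
    exact add_mem h2 h1

section
variable {D : Set (Fin n)} {W : Type*} [AddCommGroup W] [Module K W] [Module (In K n) W]
    [IsScalarTower K (In K n) W]
    {w : (Fin n → ℤ) → W} {mu : Fin n → K}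

open Classical in
/-- weight -/
noncomputable def wtD (D : Set (Fin n)) (mu : Fin n → K) (k : Fin n → ℤ) : Fin n → K :=
  fun i => (if i ∈ D then 0 else mu i) + (k i : K) + 1

theorem wtD_inj : Function.Injective (wtD D mu) := by
  intro k k' h
  funext i
  have := congrFun h i
  simpa [wtD] using this

theorem dat_wt {m : ℤ} (h : Dat D w mu m) (k : Fin n → ℤ) (i : Fin n) :
    HEl K n i • w k = wtD D mu k i • w k := by
  rw [HEl, mul_smul, h.x, In_smul_K, h.d, add_sub_cancel_right]
  rfl

theorem dat_mem {m : ℤ} (h : Dat D w mu m) (k : Fin n → ℤ) :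
    w k ∈ genWeightSpace K n W (wtD D mu k) :=
  weight_mem (dat_wt h k)

theorem dat_indep {m : ℤ} (h : Dat D w mu m) (s : Finset (Fin n → ℤ)) (c : (Fin n → ℤ) → K)
    (hs : ∑ k ∈ s, c k • w k = 0) : ∀ k ∈ s, c k • w k = 0 := by
  classical
  intro k hk
  have hd := genWS_indep (K := K) (n := n) (M := W) (wtD D mu k)
  rw [Submodule.disjoint_def] at hd
  refine hd _ (Submodule.smul_mem _ _ (dat_mem h k)) ?_
  rw [← Finset.add_sum_erase _ _ hk] at hs
  rw [eq_neg_of_add_eq_zero_left hs]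
  refine neg_mem (Submodule.sum_mem _ fun k' hk' => ?_)
  refine Submodule.smul_mem _ _ ?_
  refine Submodule.mem_iSup_of_mem (wtD D mu k') (Submodule.mem_iSup_of_mem ?_ (dat_mem h k'))
  exact fun h => Finset.ne_of_mem_erase hk' (wtD_inj h)

theorem dat_kill (h : ∀ m, Dat D w mu m) (hne : ∀ k, (∀ i ∈ D, 0 ≤ k i) → w k ≠ 0)
    (a : In K n) (ha : ∀ v : W, a • v = 0) : a ∈ aIdeal K n Dᶜ := by
  classical
  obtain ⟨N, L, h0, h1, h2⟩ := good_all D W (P K n) a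
  refine mem_aIdeal_of_kill Dᶜ N (Finset.univ.filter (fun i => i ∉ D)) (by simp) a ?_
  intro k hk
  by_cases hkD : ∃ i ∈ D, k i < 0
  · obtain ⟨i, _, hi⟩ := hkD
    rw [wP_neg (K := K) i hi, smul_zero]
  push Not at hkD
  set β : Fin n → ℤ := fun i => if i ∈ D then k i else 0 with hβ
  set z : Fin n → ℤ := fun i => if i ∈ D then 0 else k i with hz
  have hkβ : β + z = k := by
    funext i
    by_cases hi : i ∈ D <;> simp [hβ, hz, hi]
  have hz0 : ∀ i ∈ D, z i = 0 := fun i hi => by simp [hz, hi]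
  set g : GG K n := Finsupp.single β 1 with hg
  have hgR : g ∈ RG K D 0 := single_mem_RG (fun j hj => by simp [hβ, hj]) _
  have hcoef : ∀ k', (∀ i ∈ D, 0 ≤ k' i) → L g k' = 0 := by
    intro k' hk'
    refine MvPolynomial.funext_set (fun i => Set.range fun y : ℤ => mu i + (y : K)) ?_ ?_
    · intro i
      exact Set.infinite_range_of_injective fun a b hab => by simpa using hab
    · intro p hp
      rw [map_zero]
      choose y hy using fun i => hp i (Set.mem_univ i)
      simp only at hy
      set y' : Fin n → ℤ := fun i => if i ∈ D then 0 else y i with hy'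
      have hD' : ∀ i ∈ D, y' i = 0 := fun i hi => by simp [hy', hi]
      have hdat := dat_shift h y' hD' p (fun i hi => by simp [hy', hi, hy])
      have e1 := h1 _ p 0 (hdat _) g hgR
      rw [ha, evG_apply] at e1
      by_cases hmem : k' ∈ (L g).support
      · have e2 := dat_indep (hdat 0) _ (fun k => MvPolynomial.eval p (L g k)) e1.symm k' hmem
        refine (smul_eq_zero.1 e2).resolve_right (hne _ fun i hi => ?_)
        simpa [hD' i hi] using hk' i hi
      · rw [Finsupp.notMem_support_iff.1 hmem, map_zero]
  have hP := h2 _ _ 0 (dat_P D z hz0 (0 - N) (fun i hi => by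
    have := hk i (by simp [hi])
    simp [hz, hi]; omega)) g hgR
  rw [hg, evG_single] at hP
  simp only [map_one, one_smul, hkβ] at hP
  rw [hP, evG_apply]
  refine Finset.sum_eq_zero fun k' _ => ?_
  by_cases hk' : ∀ i ∈ D, 0 ≤ k' i
  · rw [hcoef k' hk', map_zero, zero_smul]
  · push Not at hk'
    obtain ⟨i, hi, hlt⟩ := hk'
    rw [wP_neg (K := K) i (by simpa [hz0 i hi] using hlt), smul_zero]

theorem dat_span [IsSimpleModule (In K n) W] (h : ∀ m, Dat D w mu m)
    (hne : ∀ k, (∀ i ∈ D, 0 ≤ k i) → w k ≠ 0) :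
    Submodule.span K (Set.range w) = ⊤ := by
  classical
  have hst : ∀ a : In K n, ∀ v ∈ Submodule.span K (Set.range w),
      a • v ∈ Submodule.span K (Set.range w) := by
    have hgen : ∀ a : In K n, (∀ k, a • w k ∈ Submodule.span K (Set.range w)) →
        ∀ v ∈ Submodule.span K (Set.range w), a • v ∈ Submodule.span K (Set.range w) := by
      intro a ha v hv
      induction hv using Submodule.span_induction with
      | mem v hv => obtain ⟨k, rfl⟩ := hv; exact ha k
      | zero => simp
      | add x y _ _ hx hy => rw [smul_add]; exact add_mem hx hy
      | smul c x _ hx => rw [In_smul_K]; exact Submodule.smul_mem _ _ hx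
    intro a
    induction a using In_induction with
    | hc c => intro v hv; rw [algebraMap_smul]; exact Submodule.smul_mem _ _ hv
    | hx i =>
      refine hgen _ fun k => ?_
      rw [(h 0).x]
      exact Submodule.smul_mem _ _ (Submodule.subset_span ⟨_, rfl⟩)
    | hd i =>
      refine hgen _ fun k => ?_
      rw [(h 0).d]
      exact Submodule.subset_span ⟨_, rfl⟩
    | hs i =>
      refine hgen _ fun k => ?_
      obtain ⟨c, hc⟩ := (Set.finite_range k).bddBelow
      rw [(h c).s _ _ (fun j _ => hc ⟨j, rfl⟩)]
      split_ifs
      · exact zero_mem _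
      · exact Submodule.subset_span ⟨_, rfl⟩
    | hadd a b ha hb => intro v hv; rw [add_smul]; exact add_mem (ha v hv) (hb v hv)
    | hmul a b ha hb => intro v hv; rw [mul_smul]; exact ha _ (hb v hv)
  let T : Submodule (In K n) W :=
    { Submodule.span K (Set.range w) with smul_mem' := fun a v hv => hst a v hv }
  have hT : T = ⊤ := by
    refine (eq_bot_or_eq_top T).resolve_left fun hb => ?_
    have : w 0 ∈ T := Submodule.subset_span (s := Set.range w) (R := K) ⟨0, rfl⟩
    rw [hb] at this
    exact hne 0 (fun i _ => le_rfl) ((Submodule.mem_bot _).1 this)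
  rw [eq_top_iff]
  intro v _
  have : v ∈ T := by rw [hT]; trivial
  exact this

theorem dat_sd [IsSimpleModule (In K n) W] (h : ∀ m, Dat D w mu m)
    (hne : ∀ k, (∀ i ∈ D, 0 ≤ k i) → w k ≠ 0) (i : Fin n) (hi : i ∉ D) (v : W) :
    intEl K n i • dEl K n i • v = v := by
  have hv : v ∈ Submodule.span K (Set.range w) := by rw [dat_span h hne]; trivial
  induction hv using Submodule.span_induction with
  | mem v hv =>
    obtain ⟨k, rfl⟩ := hv
    rw [(h 0).d]
    obtain ⟨c, hc⟩ := (Set.finite_range (k - Pi.single i 1)).bddBelow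
    rw [(h c).s _ _ (fun j _ => hc ⟨j, rfl⟩), if_neg (by tauto), sub_add_cancel]
  | zero => simp
  | add x y _ _ hx hy => rw [smul_add, smul_add, hx, hy]
  | smul c x _ hx => rw [In_smul_K, In_smul_K, hx]

end

end Aux5

section Aux6

variable {K : Type*} [Field K] [CharZero K]

theorem d_pow_mul_x (t : ℕ) : dEl K 1 0 ^ (t + 1) * xEl K 1 0
    = xEl K 1 0 * dEl K 1 0 ^ (t + 1) + ((t + 1 : ℕ) : In K 1) * dEl K 1 0 ^ t := by
  induction t with
  | zero => simpa using d_mul_x (K := K) (n := 1) 0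
  | succ t ih =>
    rw [pow_succ', mul_assoc, ih, mul_add, ← mul_assoc, d_mul_x]
    rw [← mul_assoc, (Nat.cast_commute (t + 1) (dEl K 1 0)).symm.eq, mul_assoc, ← pow_succ']
    push_cast
    noncomm_ring

theorem e_eq (s t : ℕ) : eEl1 K s t
    = intEl K 1 0 ^ s * (1 - intEl K 1 0 * dEl K 1 0) * dEl K 1 0 ^ t := by
  rw [eEl1, pow_succ, pow_succ']
  noncomm_ring

theorem e_mem (s t : ℕ) : eEl1 K s t ∈ Fideal K := Submodule.subset_span ⟨s, t, rfl⟩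

theorem e_mul_mem (a : In K 1) : ∀ f ∈ Fideal K, f * a ∈ Fideal K := by
  have hgen : ∀ a : In K 1, (∀ s t, eEl1 K s t * a ∈ Fideal K) → ∀ f ∈ Fideal K,
      f * a ∈ Fideal K := by
    intro a ha f hf
    induction hf using Submodule.span_induction with
    | mem f hf => obtain ⟨s, t, rfl⟩ := hf; exact ha s t
    | zero => simp
    | add x y _ _ hx hy => rw [add_mul]; exact add_mem hx hy
    | smul r x _ hx => rw [smul_eq_mul, mul_assoc]; exact Submodule.smul_mem _ r hx
  induction a using In_induction with
  | hc c =>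
    intro f hf
    rw [← Algebra.commutes]
    exact Submodule.smul_mem _ (algebraMap K (In K 1) c) hf
  | hx i =>
    obtain rfl : i = 0 := Subsingleton.elim _ _
    refine hgen _ fun s t => ?_
    have h0 : (1 - intEl K 1 0 * dEl K 1 0) * xEl K 1 0 = 0 := by
      rw [sub_mul, mul_assoc, s_mul_d_mul_x, one_mul, sub_self]
    rcases t with _ | t
    · rw [e_eq, pow_zero, mul_one, mul_assoc, h0, mul_zero]
      exact zero_mem _
    · rw [e_eq, mul_assoc, d_pow_mul_x, mul_add, ← mul_assoc, mul_assoc (intEl K 1 0 ^ s), h0,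
        mul_zero, zero_mul, zero_add, ← mul_assoc, ← (Nat.cast_commute (t + 1) _).eq, mul_assoc,
        ← e_eq]
      exact Submodule.smul_mem _ ((t + 1 : ℕ) : In K 1) (e_mem s t)
  | hd i =>
    obtain rfl : i = 0 := Subsingleton.elim _ _
    refine hgen _ fun s t => ?_
    have : eEl1 K s t * dEl K 1 0 = eEl1 K s (t + 1) := by
      rw [e_eq, e_eq, mul_assoc, ← pow_succ]
    rw [this]
    exact e_mem _ _
  | hs i =>
    obtain rfl : i = 0 := Subsingleton.elim _ _
    refine hgen _ fun s t => ?_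
    rcases t with _ | t
    · have h0 : (1 - intEl K 1 0 * dEl K 1 0) * intEl K 1 0 = 0 := by
        rw [sub_mul, mul_assoc, d_mul_s, one_mul, mul_one, sub_self]
      rw [e_eq, pow_zero, mul_one, mul_assoc, h0, mul_zero]
      exact zero_mem _
    · have : eEl1 K s (t + 1) * intEl K 1 0 = eEl1 K s t := by
        rw [e_eq, e_eq, mul_assoc, pow_succ, mul_assoc (dEl K 1 0 ^ t), d_mul_s, mul_one]
      rw [this]
      exact e_mem _ _
  | hadd a b ha hb => intro f hf; rw [mul_add]; exact add_mem (ha f hf) (hb f hf)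
  | hmul a b ha hb => intro f hf; rw [← mul_assoc]; exact hb _ (ha f hf)

theorem msl_sd (mu : K) (v : Msl K 1 mu) : intEl K 1 0 • dEl K 1 0 • v = v := by
  obtain ⟨a, rfl⟩ := Submodule.Quotient.mk_surjective (MslIdeal K 1 mu) v
  have h1 : (1 - intEl K 1 0 * dEl K 1 0) * a ∈ MslIdeal K 1 mu := by
    have h := e_mul_mem a _ (e_mem (K := K) 0 0)
    rw [e_eq] at h
    exact Submodule.mem_sup_left (by simpa using h)
  have h2 := (Submodule.Quotient.mk_eq_zero (MslIdeal K 1 mu)).2 h1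
  rw [sub_mul, one_mul, Submodule.Quotient.mk_sub, sub_eq_zero, mul_assoc] at h2
  exact h2.symm

theorem msl_H (mu : K) (a : In K 1) :
    (Submodule.Quotient.mk (p := MslIdeal K 1 mu) (a * HEl K 1 0) : Msl K 1 mu)
     = mu • (Submodule.Quotient.mk (p := MslIdeal K 1 mu) a : Msl K 1 mu) := by
  have h1 : a * (HEl K 1 0 - algebraMap K (In K 1) mu) ∈ MslIdeal K 1 mu := by
    refine Submodule.mem_sup_right (Submodule.smul_mem _ a ?_)
    exact Submodule.subset_span (by simp)
  have h2 := (Submodule.Quotient.mk_eq_zero (MslIdeal K 1 mu)).2 h1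
  rw [mul_sub, Submodule.Quotient.mk_sub, sub_eq_zero] at h2
  rw [← Algebra.commutes, ← Algebra.smul_def] at h2
  exact h2

noncomputable def mkM (mu : K) (a : In K 1) : Msl K 1 mu :=
  Submodule.Quotient.mk (p := MslIdeal K 1 mu) a

theorem mkM_smul (mu : K) (a b : In K 1) : a • mkM mu b = mkM mu (a * b) := rfl

theorem mkM_surj (mu : K) (v : Msl K 1 mu) : ∃ a, mkM mu a = v :=
  Submodule.Quotient.mk_surjective (MslIdeal K 1 mu) v

theorem mkM_H (mu : K) (a : In K 1) : mkM mu (a * HEl K 1 0) = mu • mkM mu a := msl_H mu a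

theorem fam_msl {N : Type*} [AddCommGroup N] [Module K N] [Module (In K 1) N]
    [IsScalarTower K (In K 1) N] [Nontrivial N] (mu : K) (e : N ≃ₗ[In K 1] Msl K 1 mu) :
    ∃ v : ℤ → N, (∀ k, dEl K 1 0 • v k = v (k - 1)) ∧
      (∀ k, xEl K 1 0 • v k = (mu - 1 + (k : K) + 1) • v (k + 1)) ∧
      (∀ k, intEl K 1 0 • v k = v (k + 1)) ∧ (∀ k, v k ≠ 0) := by
  have hsd : ∀ v : N, intEl K 1 0 • dEl K 1 0 • v = v := by
    intro v
    apply e.injective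
    rw [map_smul, map_smul, msl_sd]
  have hds : ∀ v : N, dEl K 1 0 • intEl K 1 0 • v = v := by
    intro v
    rw [← mul_smul, d_mul_s, one_smul]
  set u : N := e.symm (mkM mu 1) with hu
  have hu0 : u ≠ 0 := by
    intro h0
    rw [hu, LinearEquiv.map_eq_zero_iff] at h0
    obtain ⟨v, hv⟩ := exists_ne (0 : N)
    apply hv
    apply e.injective
    rw [map_zero]
    obtain ⟨a, ha⟩ := mkM_surj mu (e v)
    rw [← ha, ← mul_one a, ← mkM_smul, h0, smul_zero]
  have hHu : HEl K 1 0 • u = mu • u := by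
    have h1 : HEl K 1 0 • mkM mu 1 = algebraMap K (In K 1) mu • mkM mu 1 := by
      rw [algebraMap_smul, ← mkM_H, mkM_smul, one_mul, mul_one]
    rw [hu, ← map_smul, h1, map_smul, algebraMap_smul]
  let v : ℤ → N := fun k => match k with
    | Int.ofNat j => intEl K 1 0 ^ j • u
    | Int.negSucc j => dEl K 1 0 ^ (j + 1) • u
  have hs : ∀ k, intEl K 1 0 • v k = v (k + 1) := by
    rintro (j | j)
    · show intEl K 1 0 • intEl K 1 0 ^ j • u = intEl K 1 0 ^ (j + 1) • u
      rw [← mul_smul, pow_succ']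
    · rcases j with _ | j
      · show intEl K 1 0 • dEl K 1 0 ^ (0 + 1) • u = intEl K 1 0 ^ 0 • u
        rw [zero_add, pow_one, hsd, pow_zero, one_smul]
      · show intEl K 1 0 • dEl K 1 0 ^ (j + 1 + 1) • u = dEl K 1 0 ^ (j + 1) • u
        rw [pow_succ', mul_smul, hsd]
  have hd : ∀ k, dEl K 1 0 • v k = v (k - 1) := by
    intro k
    have := hs (k - 1)
    rw [sub_add_cancel] at this
    rw [← this, hds]
  have hsx : ∀ y : N, xEl K 1 0 • y = intEl K 1 0 • HEl K 1 0 • y := by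
    intro y
    rw [← mul_smul, HEl, s_mul_d_mul_x]
  have hHs : ∀ y : N, HEl K 1 0 • intEl K 1 0 • y = intEl K 1 0 • HEl K 1 0 • y
      + intEl K 1 0 • y := by
    intro y
    have h1 : HEl K 1 0 * intEl K 1 0 = intEl K 1 0 * HEl K 1 0 + intEl K 1 0 := by
      rw [HEl, s_mul_d_mul_x, d_mul_x, add_mul, mul_assoc, d_mul_s, one_mul, mul_one]
    rw [← mul_smul, h1, add_smul, mul_smul]
  have hH : ∀ k, HEl K 1 0 • v k = (mu + (k : K)) • v k := by
    intro k
    induction k using Int.induction_on with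
    | zero =>
      show HEl K 1 0 • intEl K 1 0 ^ 0 • u = (mu + ((0 : ℤ) : K)) • intEl K 1 0 ^ 0 • u
      simpa using hHu
    | succ k ih =>
      rw [← hs, hHs, ih, In_smul_K]
      generalize intEl K 1 0 • v (k : ℤ) = y
      push_cast
      module
    | pred k ih =>
      have h1 := hHs (v (-(k : ℤ) - 1))
      rw [hs, sub_add_cancel, ih] at h1
      have h2 := congrArg (fun y => dEl K 1 0 • y) h1
      simp only [smul_add, hds, In_smul_K, hd] at h2
      rw [eq_sub_of_add_eq h2.symm]
      push_cast
      module
  refine ⟨v, hd, ?_, hs, ?_⟩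
  · intro k
    rw [hsx, hH, In_smul_K, hs]
    congr 1
    ring
  · intro k
    have h0 : v 0 ≠ 0 := by
      show intEl K 1 0 ^ 0 • u ≠ 0
      simpa using hu0
    induction k using Int.induction_on with
    | zero => exact h0
    | succ k ih => 
      intro h
      rw [← hs] at h
      have h1 := hds (v (k : ℤ))
      rw [h, smul_zero] at h1
      exact ih h1.symm
    | pred k ih =>
      intro h
      rw [← hd] at h
      have h1 := hsd (v (-(k : ℤ)))
      rw [h, smul_zero] at h1
      exact ih h1.symm

theorem fam_P {N : Type*} [AddCommGroup N] [Module K N] [Module (In K 1) N]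
    [IsScalarTower K (In K 1) N] (e : N ≃ₗ[In K 1] P K 1) :
    ∃ v : ℤ → N, (∀ k, dEl K 1 0 • v k = v (k - 1)) ∧
      (∀ k, xEl K 1 0 • v k = ((k : K) + 1) • v (k + 1)) ∧
      (∀ k, intEl K 1 0 • v k = if k = -1 then 0 else v (k + 1)) ∧ (∀ k, 0 ≤ k → v k ≠ 0) ∧
      (∀ k, k < 0 → v k = 0) := by
  have ha : ∀ k : ℤ, ((fun _ => k) + Pi.single 0 1 : Fin 1 → ℤ) = fun _ => k + 1 := by
    intro k; funext i; obtain rfl : i = 0 := Subsingleton.elim _ _; simp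
  have hb : ∀ k : ℤ, ((fun _ => k) - Pi.single 0 1 : Fin 1 → ℤ) = fun _ => k - 1 := by
    intro k; funext i; obtain rfl : i = 0 := Subsingleton.elim _ _; simp
  refine ⟨fun k => e.symm (wP K (fun _ => k)), ?_, ?_, ?_, ?_, ?_⟩
  · intro k
    rw [← map_smul, wP_d, hb]
  · intro k
    rw [← map_smul, wP_x, ha, ← algebraMap_smul (In K 1), map_smul, algebraMap_smul]
  · intro k
    rw [← map_smul]
    split_ifs with h
    · rw [wP_neg (K := K) 0 (by simp [h]), smul_zero, map_zero]
    · rw [wP_s _ _ h, ha]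
  · intro k hk
    rw [Ne, LinearEquiv.map_eq_zero_iff]
    exact wP_ne fun _ => hk
  · intro k hk
    simp only [wP_neg (K := K) (k := fun _ : Fin 1 => k) 0 hk, map_zero]

end Aux6

section Aux7

theorem tprod_ne_zero {K : Type*} [Field K] {n : ℕ} {V : Fin n → Type*}
    [∀ i, AddCommGroup (V i)] [∀ i, Module K (V i)] (v : ∀ i, V i) (hv : ∀ i, v i ≠ 0) :
    PiTensorProduct.tprod K v ≠ 0 := by
  have : ∀ i, ∃ f : V i →ₗ[K] K, f (v i) ≠ 0 := by
    intro i
    by_contra! h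
    exact hv i ((Module.forall_dual_apply_eq_zero_iff K (v i)).1 h)
  choose f hf using this
  intro h0
  have h1 := congrArg (PiTensorProduct.lift
    ((MultilinearMap.mkPiAlgebra K (Fin n) K).compLinearMap f)) h0
  rw [PiTensorProduct.lift.tprod, map_zero, MultilinearMap.compLinearMap_apply,
    MultilinearMap.mkPiAlgebra_apply, Finset.prod_eq_zero_iff] at h1
  obtain ⟨i, _, hi⟩ := h1
  exact hf i hi

theorem factor_nontrivial {K : Type*} [Field K] {n : ℕ} {V : Fin n → Type*}
    [∀ i, AddCommGroup (V i)] [∀ i, Module K (V i)] (h : Nontrivial (⨂[K] j, V j)) (i : Fin n) :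
    Nontrivial (V i) := by
  by_contra hi
  rw [not_nontrivial_iff_subsingleton] at hi
  obtain ⟨t, ht⟩ := exists_ne (0 : ⨂[K] j, V j)
  apply ht
  have hz : ∀ t : ⨂[K] j, V j, t = 0 := by
    intro t
    induction t using PiTensorProduct.induction_on with
    | smul_tprod r f =>
      rw [MultilinearMap.map_coord_zero _ i (Subsingleton.elim _ _), smul_zero]
    | add x y hx hy => rw [hx, hy, add_zero]
  exact hz t

universe u

theorem tprodMap_tprod {K : Type u} [Field K] [CharZero K] {n : ℕ} (Mi : Fin n → ModN K 1)
    (i : Fin n) (a : In K 1) (v : ∀ j, (Mi j).carrier) :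
    tprodMap K n Mi i a (PiTensorProduct.tprod K v)
      = PiTensorProduct.tprod K (Function.update v i (a • v i)) := by
  rw [tprodMap, PiTensorProduct.map_tprod]
  congr 1
  funext j
  by_cases h : j = i
  · subst h
    simp only [Function.update_self]
    rfl
  · simp [Function.update_of_ne h]

open Classical in
theorem realizes_dat {K : Type u} [Field K] [CharZero K] {n : ℕ} {W : Type*} [AddCommGroup W]
    [Module K W] [Module (In K n) W] [IsScalarTower K (In K n) W] [Nontrivial W]
    (lam : Fin n → K) (D : Set (Fin n)) (h : RealizesMD K n lam D W) :
    ∃ w : (Fin n → ℤ) → W, (∀ m, Dat D w (fun i => lam i - 1) m) ∧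
      (∀ k, (∀ i ∈ D, 0 ≤ k i) → w k ≠ 0) ∧ (∀ k, (∃ i ∈ D, k i < 0) → w k = 0) := by
  obtain ⟨Mi, hP, hMs, φ, hφ⟩ := h
  have hnt : Nontrivial (⨂[K] j, (Mi j).carrier) := φ.symm.toEquiv.nontrivial
  have hn : ∀ i, Nontrivial (Mi i).carrier := factor_nontrivial hnt
  have hfam : ∀ i, ∃ v : ℤ → (Mi i).carrier, (∀ k, dEl K 1 0 • v k = v (k - 1)) ∧
      (∀ k, xEl K 1 0 • v k = ((if i ∈ D then 0 else lam i - 1) + (k : K) + 1) • v (k + 1)) ∧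
      (∀ k, intEl K 1 0 • v k = if i ∈ D ∧ k = -1 then 0 else v (k + 1)) ∧
      (∀ k, (i ∈ D → 0 ≤ k) → v k ≠ 0) ∧ (∀ k, i ∈ D → k < 0 → v k = 0) := by
    intro i
    by_cases hi : i ∈ D
    · obtain ⟨e⟩ := hP i hi
      obtain ⟨v, h1, h2, h3, h4, h5⟩ := fam_P e
      refine ⟨v, h1, ?_, ?_, fun k hk => h4 k (hk hi), fun k _ hk => h5 k hk⟩
      · intro k; rw [h2, if_pos hi, zero_add]
      · intro k; rw [h3]; simp [hi]
    · obtain ⟨e⟩ := hMs i hi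
      obtain ⟨v, h1, h2, h3, h4⟩ := fam_msl (lam i) e
      refine ⟨v, h1, ?_, ?_, fun k hk => h4 k, fun k h => absurd h hi⟩
      · intro k; rw [h2, if_neg hi]
      · intro k; rw [h3]; simp [hi]
  choose v hd hx hs hne hz using hfam
  have hupd : ∀ (k : Fin n → ℤ) (i : Fin n) (z : ℤ),
      Function.update (fun j => v j (k j)) i (v i (k i + z))
        = fun j => v j ((k + Pi.single i z : Fin n → ℤ) j) := by
    intro k i z
    funext j
    by_cases h : j = i
    · subst h; simp
    · simp [Function.update_of_ne h, Pi.single_eq_of_ne h]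
  refine ⟨fun k => φ.symm (PiTensorProduct.tprod K fun i => v i (k i)), ?_, ?_, ?_⟩
  · intro m
    refine ⟨?_, ?_, ?_⟩
    · intro i k
      rw [← φ.injective.eq_iff]
      rw [(hφ i _).2.1, φ.apply_symm_apply, φ.apply_symm_apply, tprodMap_tprod, hd,
        sub_eq_add_neg, hupd, sub_eq_add_neg, ← Pi.single_neg]
    · intro i k
      rw [← φ.injective.eq_iff]
      rw [(hφ i _).1, map_smul, φ.apply_symm_apply, φ.apply_symm_apply, tprodMap_tprod, hx,
        MultilinearMap.map_update_smul, hupd]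
    · intro i k _
      rw [← φ.injective.eq_iff]
      rw [(hφ i _).2.2, φ.apply_symm_apply, tprodMap_tprod, hs]
      split_ifs with h
      · rw [map_zero]
        exact MultilinearMap.map_coord_zero _ i (by simp)
      · rw [φ.apply_symm_apply, hupd]
  · intro k hk
    rw [Ne, LinearEquiv.map_eq_zero_iff]
    exact tprod_ne_zero _ fun i => hne i _ (hk i)
  · rintro k ⟨i, hi, hk⟩
    rw [LinearEquiv.map_eq_zero_iff]
    exact MultilinearMap.map_coord_zero _ i (hz i _ hi hk)

theorem supp_wt {K : Type*} [Field K] [CharZero K] {n : ℕ} (lam : Fin n → K) (D : Set (Fin n))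
    (mu : Fin n → K) : mu ∈ SuppMD K n lam D ↔
      ∃ k : Fin n → ℤ, (∀ i ∈ D, 0 ≤ k i) ∧ mu = wtD D (fun i => lam i - 1) k := by
  constructor
  · rintro ⟨h1, h2⟩
    have : ∀ i, ∃ z : ℤ, (i ∈ D → 0 ≤ z) ∧ mu i = wtD D (fun i => lam i - 1) (fun _ => z) i := by
      intro i
      by_cases hi : i ∈ D
      · obtain ⟨m, hm, h⟩ := h1 i hi
        refine ⟨(m : ℤ) - 1, fun _ => by omega, ?_⟩
        rw [h, wtD, if_pos hi]; push_cast; ring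
      · obtain ⟨z, h⟩ := h2 i hi
        refine ⟨z, fun h => absurd h hi, ?_⟩
        rw [h, wtD, if_neg hi]; ring
    choose k hk1 hk2 using this
    exact ⟨k, hk1, funext hk2⟩
  · rintro ⟨k, hk, rfl⟩
    constructor
    · intro i hi
      refine ⟨(k i).toNat + 1, by omega, ?_⟩
      have h0 : ((k i).toNat : ℤ) = k i := Int.toNat_of_nonneg (hk i hi)
      have h : ((k i).toNat : K) = (k i : K) := by
        rw [← Int.cast_natCast, h0]
      rw [wtD, if_pos hi]; push_cast; rw [h]; ring
    · intro i hi
      refine ⟨k i, ?_⟩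
      rw [wtD, if_neg hi]; ring

end Aux7

section Aux8

variable {K : Type*} [Field K] [CharZero K] {n : ℕ}

theorem gw_map {M N : Type*} [AddCommGroup M] [Module K M] [Module (In K n) M]
    [IsScalarTower K (In K n) M] [AddCommGroup N] [Module K N] [Module (In K n) N]
    [IsScalarTower K (In K n) N] (f : M →ₗ[In K n] N) {lam : Fin n → K} {v : M}
    (hv : v ∈ genWeightSpace K n M lam) : f v ∈ genWeightSpace K n N lam := by
  obtain ⟨N, hN⟩ := hv
  exact ⟨N, fun i => by rw [← map_smul, hN i, map_zero]⟩

theorem gw_comap {M N : Type*} [AddCommGroup M] [Module K M] [Module (In K n) M]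
    [IsScalarTower K (In K n) M] [AddCommGroup N] [Module K N] [Module (In K n) N]
    [IsScalarTower K (In K n) N] (f : M →ₗ[In K n] N) (hf : Function.Injective f)
    {lam : Fin n → K} {v : M}
    (hv : f v ∈ genWeightSpace K n N lam) : v ∈ genWeightSpace K n M lam := by
  obtain ⟨N, hN⟩ := hv
  exact ⟨N, fun i => hf (by rw [map_smul, hN i, map_zero])⟩

theorem gw_zero {M : Type*} [AddCommGroup M] [Module K M] [Module (In K n) M]
    [IsScalarTower K (In K n) M] {lam : Fin n → K} {v : M}
    (hv : v ∈ genWeightSpace K n M lam)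
    (hv' : v ∈ ⨆ mu, ⨆ (_ : mu ≠ lam), genWeightSpace K n M mu) : v = 0 :=
  (Submodule.disjoint_def.1 (genWS_indep (K := K) (n := n) (M := M) lam)) v hv hv'

theorem ann_of_sd {M : Type*} [AddCommGroup M] [Module (In K n) M] (I : Set (Fin n))
    (h : ∀ i ∈ I, ∀ m : M, intEl K n i • dEl K n i • m = m) (a : In K n)
    (ha : a ∈ aIdeal K n I) (m : M) : a • m = 0 := by
  have hle : aIdeal K n I ≤ TwoSidedIdeal.ker (Module.toAddMonoidEnd (In K n) M) := by
    refine iSup_le fun i => iSup_le fun hi => ?_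
    refine TwoSidedIdeal.span_le.2 ?_
    rintro _ ⟨s, t, rfl⟩
    rw [SetLike.mem_coe, TwoSidedIdeal.mem_ker]
    ext m
    show eElN K n i s t • m = 0
    have : eElN K n i s t = intEl K n i ^ s * (1 - intEl K n i * dEl K n i) * dEl K n i ^ t := by
      rw [eElN, pow_succ, pow_succ']
      noncomm_ring
    rw [this, mul_smul, mul_smul, sub_smul, one_smul, mul_smul, h i hi, sub_self, smul_zero]
  have := hle ha
  rw [TwoSidedIdeal.mem_ker] at this
  exact DFunLike.congr_fun this m

theorem prime_of_simple {S : Type*} [AddCommGroup S] [Module K S] [Module (In K n) S]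
    [IsScalarTower K (In K n) S] [hS : IsSimpleModule (In K n) S] :
    IsPrimeSet K n (annSet K n S) := by
  have hnt : Nontrivial S := IsSimpleModule.nontrivial (In K n) S
  constructor
  · intro h
    obtain ⟨v, hv⟩ := exists_ne (0 : S)
    have h1 : (1 : In K n) ∈ annSet K n S := by rw [h]; trivial
    exact hv (by simpa using h1 v)
  · intro a b hab
    by_contra! hc
    obtain ⟨ha, hb⟩ := hc
    apply ha
    have : ∃ s : S, b • s ≠ 0 := by
      by_contra! h
      exact hb h
    obtain ⟨s, hs⟩ := this
    intro t
    obtain ⟨r, rfl⟩ := IsSimpleModule.toSpanSingleton_surjective (In K n) hs t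
    have := hab r s
    rw [mul_smul, mul_smul] at this
    exact this

theorem key {M : Type*} [AddCommGroup M] [Module K M] [Module (In K n) M]
    [IsScalarTower K (In K n) M] {lam : Fin n → K} {D : Set (Fin n)} (hM : InGWD K n lam D M)
    (p : Submodule (In K n) M) (v : M) (hv : v ∉ p) :
    ∃ p' q' : Submodule (In K n) M, p ≤ p' ∧ p' ≤ q' ∧ v ∉ p' ∧ v ∈ q' ∧
      q' = p ⊔ Submodule.span (In K n) {v} ∧
      IsSimpleModule (In K n) (q' ⧸ Submodule.comap q'.subtype p') ∧
      ∃ w : (Fin n → ℤ) → (q' ⧸ Submodule.comap q'.subtype p'),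
      (∀ m, Dat D w (fun i => lam i - 1) m) ∧
      (∀ k, (∀ i ∈ D, 0 ≤ k i) → w k ≠ 0) ∧ (∀ k, (∃ i ∈ D, k i < 0) → w k = 0) := by
  obtain ⟨p', h1, h2, h3, h4⟩ := exists_simple_subfactor p v hv
  have hnt := IsSimpleModule.nontrivial (In K n) (↥(p ⊔ Submodule.span (In K n) {v}) ⧸
        Submodule.comap (p ⊔ Submodule.span (In K n) {v}).subtype p')
  exact ⟨p', _, h1, h2, h3, Submodule.mem_sup_right (Submodule.mem_span_singleton_self v), rfl, h4,
    realizes_dat lam D (hM.2.2 p' _ h2 h4)⟩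

theorem M_sd {M : Type*} [AddCommGroup M] [Module K M] [Module (In K n) M]
    [IsScalarTower K (In K n) M] {lam : Fin n → K} {D : Set (Fin n)} (hM : InGWD K n lam D M)
    (i : Fin n) (hi : i ∈ Dᶜ) (m : M) : intEl K n i • dEl K n i • m = m := by
  by_contra hne
  have hv : m - intEl K n i • dEl K n i • m ∉ (⊥ : Submodule (In K n) M) := by
    rw [Submodule.mem_bot, sub_eq_zero]
    exact fun h => hne h.symm
  obtain ⟨p', q', -, -, h3, h4, -, hS, w, hw, hw0, -⟩ := key hM ⊥ _ hv
  set v := m - intEl K n i • dEl K n i • m with hvd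
  have hdv : dEl K n i • v = 0 := by
    rw [hvd, smul_sub, ← mul_smul (dEl K n i) (intEl K n i), d_mul_s, one_smul, sub_self]
  have h5 := dat_sd hw hw0 i hi (Submodule.Quotient.mk ⟨v, h4⟩)
  rw [← Submodule.Quotient.mk_smul] at h5
  have h6 : dEl K n i • (⟨v, h4⟩ : q') = 0 := Subtype.ext hdv
  rw [h6, Submodule.Quotient.mk_zero, smul_zero] at h5
  have h7 := (Submodule.Quotient.mk_eq_zero _).1 h5.symm
  exact h3 h7

theorem sub_ann {M : Type*} [AddCommGroup M] [Module K M] [Module (In K n) M]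
    [IsScalarTower K (In K n) M] {lam : Fin n → K} {D : Set (Fin n)} (hM : InGWD K n lam D M)
    (p q : Submodule (In K n) M) (v : M) (hvq : v ∈ q) (hvp : v ∉ p) (hpq : p ≤ q) (a : In K n)
    (ha : ∀ m ∈ q, a • m ∈ p) : a ∈ aIdeal K n Dᶜ := by
  obtain ⟨p', q', h1, h2, h3, h4, h5, hS, w, hw, hw0, -⟩ := key hM p v hvp
  apply dat_kill hw hw0
  intro y
  obtain ⟨⟨y, hy⟩, rfl⟩ := Submodule.Quotient.mk_surjective _ y
  rw [← Submodule.Quotient.mk_smul, Submodule.Quotient.mk_eq_zero]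
  have hqq : q' ≤ q := by
    rw [h5]
    exact sup_le hpq ((Submodule.span_singleton_le_iff_mem _ _).2 hvq)
  exact h1 (ha y (hqq hy))

theorem main_supp {M : Type*} [AddCommGroup M] [Module K M] [Module (In K n) M]
    [IsScalarTower K (In K n) M] {lam : Fin n → K} {D : Set (Fin n)} (hM : InGWD K n lam D M)
    (hM0 : Nontrivial M) : supp K n M = SuppMD K n lam D := by
  ext mu
  constructor
  · intro hmu
    obtain ⟨v, hv, hv0⟩ := (Submodule.ne_bot_iff _).1 hmu
    obtain ⟨p', q', h1, h2, h3, h4, h5, hS, w, hw, hw0, hw1⟩ := key hM ⊥ v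
      (by rwa [Submodule.mem_bot])
    by_contra hnot
    have hvq : (⟨v, h4⟩ : q') ∈ genWeightSpace K n q' mu :=
      gw_comap q'.subtype Subtype.coe_injective hv
    have hvb := gw_map (Submodule.comap q'.subtype p').mkQ hvq
    have hz := gw_zero hvb (by
      have hsp := dat_span hw hw0
      have hle : Submodule.span K (Set.range w) ≤ ⨆ nu, ⨆ (_ : nu ≠ mu),
          genWeightSpace K n (q' ⧸ Submodule.comap q'.subtype p') nu := by
        rw [Submodule.span_le]
        rintro _ ⟨k, rfl⟩
        by_cases hk : ∃ i ∈ D, k i < 0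
        · rw [hw1 k hk]; exact zero_mem _
        · push Not at hk
          refine Submodule.mem_iSup_of_mem (wtD D (fun i => lam i - 1) k)
            (Submodule.mem_iSup_of_mem ?_ (dat_mem (hw 0) k))
          rintro rfl
          exact hnot ((supp_wt lam D _).2 ⟨k, hk, rfl⟩)
      apply hle
      rw [hsp]
      trivial)
    rw [Submodule.mkQ_apply, Submodule.Quotient.mk_eq_zero] at hz
    exact h3 hz
  · intro hmu hbot
    obtain ⟨k, hk, rfl⟩ := (supp_wt lam D mu).1 hmu
    obtain ⟨v0, hv0⟩ := exists_ne (0 : M)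
    obtain ⟨p', q', h1, h2, h3, h4, h5, hS, w, hw, hw0, hw1⟩ := key hM ⊥ v0
      (by rwa [Submodule.mem_bot])
    have hwk := dat_mem (hw 0) k
    have hne := hw0 k hk
    obtain ⟨⟨v, hv⟩, hvw⟩ := Submodule.Quotient.mk_surjective _ (w k)
    rw [← hvw] at hwk hne
    have hv1 : p'.mkQ v ∈ genWeightSpace K n (M ⧸ p') (wtD D (fun i => lam i - 1) k) :=
      gw_map (Submodule.mapQ (Submodule.comap q'.subtype p') p' q'.subtype le_rfl) hwk
    have htop : (⨆ nu, genWeightSpace K n M nu) = ⊤ := by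
      have := hM.1
      unfold IsGenWeightModule at this
      exact @DirectSum.IsInternal.submodule_iSup_eq_top _ _ _ (Classical.decEq _) _ _ _ _ this
    have hvt : v ∈ ⨆ nu, genWeightSpace K n M nu := by rw [htop]; trivial
    have hle : (⨆ nu, genWeightSpace K n M nu) ≤ Submodule.comap (p'.mkQ.restrictScalars K)
        (⨆ nu, ⨆ (_ : nu ≠ wtD D (fun i => lam i - 1) k), genWeightSpace K n (M ⧸ p') nu) := by
      refine iSup_le fun nu => ?_
      by_cases h : nu = wtD D (fun i => lam i - 1) k
      · rw [h]
        exact le_of_eq_of_le hbot bot_le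
      · intro y hy
        exact Submodule.mem_iSup_of_mem nu (Submodule.mem_iSup_of_mem h (gw_map p'.mkQ hy))
    have hz := gw_zero hv1 (hle hvt)
    rw [Submodule.mkQ_apply, Submodule.Quotient.mk_eq_zero] at hz
    apply hne
    rw [Submodule.Quotient.mk_eq_zero]
    exact hz

theorem main_all {M : Type*} [AddCommGroup M] [Module K M] [Module (In K n) M]
    [IsScalarTower K (In K n) M] {lam : Fin n → K} {D : Set (Fin n)} (hM : InGWD K n lam D M)
    (hM0 : Nontrivial M) : supp K n M = SuppMD K n lam D ∧
    annSet K n M = (aIdeal K n Dᶜ : Set (In K n)) ∧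
    IsPrimeSet K n (aIdeal K n Dᶜ : Set (In K n)) ∧
    IsAbsolutelyPrime K n M := by
  have hsub : ∀ a ∈ aIdeal K n Dᶜ, ∀ m : M, a • m = 0 := ann_of_sd _ (M_sd hM)
  have hfac : ∀ (p q : Submodule (In K n) M), p ≤ q →
    Nontrivial (q ⧸ Submodule.comap q.subtype p) →
    annSet K n (q ⧸ Submodule.comap q.subtype p) = (aIdeal K n Dᶜ : Set (In K n)) := by
    intro p q hpq hnt
    ext a
    constructor
    · intro ha
      obtain ⟨y, hy⟩ := exists_ne (0 : q ⧸ Submodule.comap q.subtype p)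
      obtain ⟨⟨v, hv⟩, rfl⟩ := Submodule.Quotient.mk_surjective _ y
      rw [Ne, Submodule.Quotient.mk_eq_zero] at hy
      refine sub_ann hM p q v hv hy hpq a fun m hm => ?_
      have := ha (Submodule.Quotient.mk ⟨m, hm⟩)
      rw [← Submodule.Quotient.mk_smul, Submodule.Quotient.mk_eq_zero] at this
      exact this
    · intro ha y
      obtain ⟨⟨v, hv⟩, rfl⟩ := Submodule.Quotient.mk_surjective _ y
      rw [← Submodule.Quotient.mk_smul, Submodule.Quotient.mk_eq_zero]
      show a • v ∈ p
      rw [hsub a ha]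
      exact zero_mem _
  obtain ⟨v0, hv0⟩ := exists_ne (0 : M)
  have hann : annSet K n M = (aIdeal K n Dᶜ : Set (In K n)) := by
    ext a
    constructor
    · intro ha
      refine sub_ann hM ⊥ ⊤ v0 trivial (by rwa [Submodule.mem_bot]) bot_le a fun m _ => ?_
      rw [Submodule.mem_bot]
      exact ha m
    · intro ha m
      exact hsub a ha m
  have hprime : IsPrimeSet K n (aIdeal K n Dᶜ : Set (In K n)) := by
    obtain ⟨p', q', h1, h2, h3, h4, h5, hS, -⟩ := key hM ⊥ v0 (by rwa [Submodule.mem_bot])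
    rw [← hfac p' q' h2 (IsSimpleModule.nontrivial (In K n) _)]
    exact prime_of_simple
  refine ⟨main_supp hM hM0, hann, hprime, ?_, ?_⟩
  · rw [hann]; exact hprime
  · intro p q hpq hnt
    rw [hann, hfac p q hpq hnt]

end Aux8

/-- every nonzero `M ∈ GW(𝕀_n, 𝒟_Ω)` has `Supp(M) = Supp(M(𝒟_Ω))` and
annihilator the prime ideal `𝔞(𝒟_Ω) = Σ_{i ∈ C𝒟_Ω} 𝔭_i`; it is absolutely
`𝔞(𝒟_Ω)`-prime. -/
theorem statement8 (K : Type*) [Field K] [CharZero K] (n : ℕ)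
    (lam : Fin n → K) (hnorm : IsNormalized K n lam)
    (D : Set (Fin n)) (hD : D ⊆ DD K n lam)
    (M : Type*) [AddCommGroup M] [Module K M] [Module (In K n) M] [IsScalarTower K (In K n) M]
    (hM0 : Nontrivial M) (hM : InGWD K n lam D M) :
    supp K n M = SuppMD K n lam D ∧
    annSet K n M = (aIdeal K n Dᶜ : Set (In K n)) ∧
    IsPrimeSet K n (aIdeal K n Dᶜ : Set (In K n)) ∧
    IsAbsolutelyPrime K n M := by
  exact main_all hM hM0

end IDO
end

section
/- Let Ω ∈ K^n/ℤ^n and let 𝒟_Ω and 𝒟_Ω′ be distinct subsets of 𝔻_Ω. Then Ext^1_{𝕀_n}(M(𝒟_Ω′), M(𝒟_Ω)) = 0; equivalently, every short exact sequence of 𝕀_n-modules 0 → M(𝒟_Ω) → N → M(𝒟_Ω′) → 0 splits. -/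
set_option maxHeartbeats 1000000
set_option synthInstance.maxHeartbeats 400000
set_option linter.unusedSectionVars false

namespace IDO

open scoped TensorProduct

namespace S10
variable {K : Type*} [Field K] [CharZero K] {n : ℕ}

lemma ext_mon {a b : In K n}
    (h : ∀ (α : Fin n →₀ ℕ) (c : K), a • (MvPolynomial.monomial α c : P K n)
      = b • (MvPolynomial.monomial α c : P K n)) : a = b := by
  have key : ∀ p : P K n, a • p = b • p := by
    intro p
    induction p using MvPolynomial.induction_on' with
    | monomial α c => exact h α c
    | add p q hp hq => rw [smul_add, smul_add, hp, hq]
  have : (show InSub K n from a) = (show InSub K n from b) :=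
    Subtype.ext (LinearMap.ext fun p => key p)
  exact this

lemma x_mon (i : Fin n) (α : Fin n →₀ ℕ) (c : K) :
    xEl K n i • (MvPolynomial.monomial α c : P K n)
      = MvPolynomial.monomial (α + Finsupp.single i 1) c := by
  rw [xEl_smul, MvPolynomial.X, MvPolynomial.monomial_mul, one_mul, add_comm]

lemma d_mon (i : Fin n) (α : Fin n →₀ ℕ) (c : K) :
    dEl K n i • (MvPolynomial.monomial α c : P K n)
      = MvPolynomial.monomial (α - Finsupp.single i 1) (c * (α i : K)) := by
  rw [dEl_smul, MvPolynomial.pderiv_monomial]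

lemma int_mon (i : Fin n) (α : Fin n →₀ ℕ) (c : K) :
    intEl K n i • (MvPolynomial.monomial α c : P K n)
      = MvPolynomial.monomial (α + Finsupp.single i 1) (c * ((α i : K) + 1)⁻¹) := by
  have h : (MvPolynomial.monomial α c : P K n)
      = c • (MvPolynomial.basisMonomials (Fin n) K α) := by
    simp [MvPolynomial.smul_monomial]
  change intOp K n i _ = _
  rw [h, map_smul, intOp, Module.Basis.constr_basis, smul_smul, MvPolynomial.smul_monomial]
  simp

lemma mon_congr {α β : Fin n →₀ ℕ} {c d : K} (h : α = β) (h' : c = d) :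
    (MvPolynomial.monomial α c : P K n) = MvPolynomial.monomial β d := by rw [h, h']

lemma nz (k : ℕ) : (k : K) + 1 ≠ 0 := by exact_mod_cast Nat.succ_ne_zero k

lemma d_int (i : Fin n) : dEl K n i * intEl K n i = 1 := by
  apply ext_mon; intro α c
  rw [mul_smul, int_mon, d_mon, one_smul]
  refine mon_congr (by simp) ?_
  have := nz (K := K) (α i)
  simp; field_simp

lemma int_H (i : Fin n) : intEl K n i * HEl K n i = xEl K n i := by
  apply ext_mon; intro α c
  rw [mul_smul, hEl_monomial, MvPolynomial.smul_monomial, int_mon, x_mon]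
  refine mon_congr rfl ?_
  have := nz (K := K) (α i)
  simp; field_simp

lemma d_x (i : Fin n) : dEl K n i * xEl K n i = xEl K n i * dEl K n i + 1 := by
  apply ext_mon; intro α c
  change HEl K n i • _ = _
  rw [hEl_monomial, add_smul, add_smul, mul_smul, d_mon, x_mon, one_smul, one_smul]
  congr 1
  rw [MvPolynomial.smul_monomial]
  by_cases h : α i = 0
  · simp [h]
  · refine mon_congr ?_ (by simp [mul_comm])
    ext j
    by_cases hj : i = j
    · subst hj; simp; omega
    · simp [Finsupp.single_apply, hj]

lemma dd_comm (i j : Fin n) (hij : i ≠ j) : Commute (dEl K n i) (dEl K n j) := by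
  apply ext_mon; intro α c
  simp only [mul_smul, d_mon]
  refine mon_congr ?_ ?_
  · ext k; simp; omega
  · simp [Finsupp.single_apply, hij, hij.symm]; ring

lemma dx_comm (i j : Fin n) (hij : i ≠ j) : Commute (dEl K n i) (xEl K n j) := by
  apply ext_mon; intro α c
  simp only [mul_smul, d_mon, x_mon]
  refine mon_congr ?_ ?_
  · ext k
    by_cases h1 : i = k
    · subst h1; simp [Finsupp.single_apply, hij.symm]
    · simp [Finsupp.single_apply, h1]
  · simp [Finsupp.single_apply, hij, hij.symm]

lemma dint_comm (i j : Fin n) (hij : i ≠ j) : Commute (dEl K n i) (intEl K n j) := by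
  apply ext_mon; intro α c
  simp only [mul_smul, d_mon, int_mon]
  refine mon_congr ?_ ?_
  · ext k
    by_cases h1 : i = k
    · subst h1; simp [Finsupp.single_apply, hij.symm]
    · simp [Finsupp.single_apply, h1]
  · simp [Finsupp.single_apply, hij, hij.symm]; ring

lemma intx_comm (i j : Fin n) (hij : i ≠ j) : Commute (intEl K n i) (xEl K n j) := by
  apply ext_mon; intro α c
  simp only [mul_smul, int_mon, x_mon]
  refine mon_congr ?_ ?_
  · abel
  · simp [Finsupp.single_apply, hij, hij.symm]

lemma intint_comm (i j : Fin n) (hij : i ≠ j) : Commute (intEl K n i) (intEl K n j) := by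
  apply ext_mon; intro α c
  simp only [mul_smul, int_mon]
  refine mon_congr ?_ ?_
  · abel
  · simp [Finsupp.single_apply, hij, hij.symm]; ring

/-- the element `e_00(i)` -/
noncomputable def e0 (i : Fin n) : In K n := 1 - intEl K n i * dEl K n i

lemma e_int (i : Fin n) : e0 i * intEl K n i = 0 := by
  rw [e0, sub_mul, mul_assoc, d_int]; simp

lemma e_x (i : Fin n) : e0 i * xEl K n i = 0 := by
  rw [← int_H, ← mul_assoc, e_int, zero_mul]

lemma H_eq (i : Fin n) : HEl K n i = xEl K n i * dEl K n i + 1 := d_x i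

lemma e_H (i : Fin n) : e0 i * HEl K n i = e0 i := by
  rw [H_eq, mul_add, ← mul_assoc, e_x]; simp

lemma dpow_x (i : Fin n) (S : ℕ) : dEl K n i ^ (S + 1) * xEl K n i
    = xEl K n i * dEl K n i ^ (S + 1) + ((S : In K n) + 1) * dEl K n i ^ S := by
  induction S with
  | zero => simp [d_x]
  | succ S ih =>
    rw [pow_succ' _ (S + 1), mul_assoc, ih, mul_add, ← mul_assoc, d_x]
    have : dEl K n i * ((S : In K n) + 1) = ((S : In K n) + 1) * dEl K n i :=
      ((Nat.commute_cast (dEl K n i) S).add_right (Commute.one_right _)).eq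
    rw [← mul_assoc (dEl K n i) _ (dEl K n i ^ S), this, pow_succ' _ S]
    push_cast
    noncomm_ring

lemma dpow_int (i : Fin n) (S : ℕ) : dEl K n i ^ (S + 1) * intEl K n i = dEl K n i ^ S := by
  rw [pow_succ, mul_assoc, d_int, mul_one]

lemma dpow_intpow (i : Fin n) (S : ℕ) : dEl K n i ^ S * intEl K n i ^ S = 1 := by
  induction S with
  | zero => simp
  | succ S ih => rw [pow_succ' (intEl K n i), ← mul_assoc, dpow_int, ih]

section
variable {M : Type*} [AddCommGroup M] [Module K M] [Module (In K n) M]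
  [IsScalarTower K (In K n) M]

lemma closed (W : Submodule K M)
    (hx : ∀ j, ∀ m ∈ W, xEl K n j • m ∈ W) (hd : ∀ j, ∀ m ∈ W, dEl K n j • m ∈ W)
    (hi : ∀ j, ∀ m ∈ W, intEl K n j • m ∈ W) (a : In K n) : ∀ m ∈ W, a • m ∈ W := by
  obtain ⟨a, ha⟩ := a
  change a ∈ Algebra.adjoin K _ at ha
  refine Algebra.adjoin_induction (p := fun a ha => ∀ m ∈ W, ((show In K n from
    (⟨a, ha⟩ : InSub K n)) • m ∈ W)) ?_ ?_ ?_ ?_ ha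
  · rintro x ((⟨j, rfl⟩ | ⟨j, rfl⟩) | ⟨j, rfl⟩) m hm
    · exact hx j m hm
    · exact hd j m hm
    · exact hi j m hm
  · intro r m hm
    change algebraMap K (In K n) r • m ∈ W
    rw [algebraMap_smul]
    exact W.smul_mem r hm
  · intro x y hx hy h1 h2 m hm
    change ((show In K n from (⟨x, hx⟩ : InSub K n)) + (show In K n from (⟨y, hy⟩ : InSub K n)))
      • m ∈ W
    rw [add_smul]
    exact W.add_mem (h1 m hm) (h2 m hm)
  · intro x y hx hy h1 h2 m hm
    change ((show In K n from (⟨x, hx⟩ : InSub K n)) * (show In K n from (⟨y, hy⟩ : InSub K n)))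
      • m ∈ W
    rw [mul_smul]
    exact h1 _ (h2 m hm)

/-- Build an `𝕀_n`-submodule from a `K`-submodule closed under generators. -/
noncomputable def mkSub (W : Submodule K M)
    (hx : ∀ j, ∀ m ∈ W, xEl K n j • m ∈ W) (hd : ∀ j, ∀ m ∈ W, dEl K n j • m ∈ W)
    (hi : ∀ j, ∀ m ∈ W, intEl K n j • m ∈ W) : Submodule (In K n) M where
  carrier := W
  add_mem' := W.add_mem
  zero_mem' := W.zero_mem
  smul_mem' := fun a m hm => closed W hx hd hi a m hm

lemma dpow_zero_mono (i : Fin n) {m : M} {S T : ℕ} (h : dEl K n i ^ S • m = 0) (hST : S ≤ T) :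
    dEl K n i ^ T • m = 0 := by
  obtain ⟨k, rfl⟩ := Nat.exists_eq_add_of_le hST
  rw [add_comm, pow_add, mul_smul, h, smul_zero]

variable (M) in
/-- `∂_i`-torsion, K-level -/
noncomputable def torK (i : Fin n) : Submodule K M where
  carrier := {m | ∃ S : ℕ, dEl K n i ^ S • m = 0}
  add_mem' := by
    rintro a b ⟨S, hS⟩ ⟨T, hT⟩
    exact ⟨max S T, by rw [smul_add, dpow_zero_mono i hS (le_max_left _ _),
      dpow_zero_mono i hT (le_max_right _ _), add_zero]⟩
  zero_mem' := ⟨0, by simp⟩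
  smul_mem' := by
    rintro c m ⟨S, hS⟩
    exact ⟨S, by rw [← smul_comm c, hS, smul_zero]⟩

lemma comm_zero {a b : In K n} (h : Commute a b) {m : M} (hm : a • m = 0) : a • b • m = 0 := by
  rw [← mul_smul, h.eq, mul_smul, hm, smul_zero]

variable (M) in
noncomputable def tor (i : Fin n) : Submodule (In K n) M := mkSub (torK (K := K) M i)
  (by
    rintro j m ⟨S, hS⟩
    by_cases h : i = j
    · subst h
      refine ⟨S + 1, ?_⟩
      rw [← mul_smul, dpow_x, add_smul, mul_smul, mul_smul, hS, pow_succ', mul_smul, hS]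
      simp
    · exact ⟨S, comm_zero ((dx_comm i j h).pow_left S) hS⟩)
  (by
    rintro j m ⟨S, hS⟩
    by_cases h : i = j
    · subst h
      exact ⟨S, comm_zero ((Commute.refl _).pow_left S) hS⟩
    · exact ⟨S, comm_zero ((dd_comm i j h).pow_left S) hS⟩)
  (by
    rintro j m ⟨S, hS⟩
    by_cases h : i = j
    · subst h
      exact ⟨S + 1, by rw [← mul_smul, dpow_int, hS]⟩
    · exact ⟨S, comm_zero ((dint_comm i j h).pow_left S) hS⟩)

variable (M) in
/-- annihilator of `F(i)`, K-level -/
noncomputable def annK (i : Fin n) : Submodule K M where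
  carrier := {m | ∀ S : ℕ, (e0 i * dEl K n i ^ S) • m = 0}
  add_mem' := by
    intro a b ha hb S
    rw [smul_add, ha, hb, add_zero]
  zero_mem' := by intro S; simp
  smul_mem' := by
    intro c m hm S
    rw [← smul_comm c, hm, smul_zero]

lemma e_comm (i : Fin n) (b : In K n) (h1 : Commute (dEl K n i) b)
    (h2 : Commute (intEl K n i) b) (S : ℕ) : Commute (e0 i * dEl K n i ^ S) b :=
  Commute.mul_left (Commute.sub_left (Commute.one_left _) (h2.mul_left h1)) (h1.pow_left S)

variable (M) in
noncomputable def ann (i : Fin n) : Submodule (In K n) M := mkSub (annK (K := K) M i)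
  (by
    intro j m hm S
    by_cases h : i = j
    · subst h
      cases S with
      | zero => rw [pow_zero, mul_one, ← mul_smul, e_x, zero_smul]
      | succ S =>
        have hc : e0 i * ((S : In K n) + 1) = ((S : In K n) + 1) * e0 i :=
          ((Nat.commute_cast (e0 i) S).add_right (Commute.one_right _)).eq
        rw [← mul_smul, mul_assoc, dpow_x, mul_add, ← mul_assoc, e_x, zero_mul, zero_add,
          ← mul_assoc, hc, mul_assoc, mul_smul, hm S, smul_zero]
    · exact comm_zero (e_comm i _ (dx_comm i j h) (intx_comm i j h) S) (hm S))
  (by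
    intro j m hm S
    by_cases h : i = j
    · subst h
      rw [← mul_smul, mul_assoc, ← pow_succ]
      exact hm (S + 1)
    · exact comm_zero (e_comm i _ (dd_comm i j h) (dint_comm j i (Ne.symm h)).symm S) (hm S))
  (by
    intro j m hm S
    by_cases h : i = j
    · subst h
      cases S with
      | zero => rw [pow_zero, mul_one, ← mul_smul, e_int, zero_smul]
      | succ S =>
        rw [← mul_smul, mul_assoc, dpow_int]
        exact hm S
    · exact comm_zero (e_comm i _ (dint_comm i j h) (intint_comm i j h) S) (hm S))

variable (M) in
noncomputable def eigK (i : Fin n) : Submodule K M :=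
  Submodule.span K {m | ∃ mu : K, HEl K n i • m = mu • m}

lemma eig_map {i : Fin n} (a : In K n) (c : K)
    (ha : HEl K n i * a = a * HEl K n i + c • a) :
    ∀ m ∈ eigK (K := K) M i, a • m ∈ eigK (K := K) M i := by
  intro m hm
  induction hm using Submodule.span_induction with
  | mem m hm =>
    obtain ⟨mu, hmu⟩ := hm
    refine Submodule.subset_span ⟨mu + c, ?_⟩
    rw [← mul_smul, ha, add_smul, mul_smul, hmu, add_smul, ← smul_comm mu a m, smul_assoc]
  | zero => simp
  | add x y _ _ hx hy => rw [smul_add]; exact add_mem hx hy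
  | smul r x _ hx => rw [← smul_comm r]; exact Submodule.smul_mem _ _ hx

end

section one
variable {M : Type*} [AddCommGroup M] [Module K M] [Module (In K 1) M]
  [IsScalarTower K (In K 1) M]

variable (M) in
noncomputable def eig : Submodule (In K 1) M := mkSub (eigK (K := K) M 0)
  (by
    intro j; obtain rfl := Subsingleton.elim j 0
    refine eig_map _ 1 ?_
    rw [HEl, mul_assoc, one_smul]
    conv_lhs => rw [← mul_assoc, d_x, add_mul, one_mul, mul_assoc])
  (by
    intro j; obtain rfl := Subsingleton.elim j 0
    refine eig_map _ (-1) ?_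
    rw [neg_smul, one_smul]
    conv_rhs => rw [H_eq, mul_add, ← mul_assoc, mul_one, add_neg_cancel_right]
    rfl)
  (by
    intro j; obtain rfl := Subsingleton.elim j 0
    refine eig_map _ 1 ?_
    rw [int_H, H_eq, add_mul, mul_assoc, d_int, one_smul]; simp)

end one

noncomputable def mslMk (mu : K) (a : In K 1) : Msl K 1 mu := Submodule.Quotient.mk (p := MslIdeal K 1 mu) a

lemma smul_mslMk (mu : K) (a b : In K 1) : a • mslMk mu b = mslMk mu (a * b) := rfl

lemma mslMk_zero (mu : K) (a : In K 1) (h : a ∈ MslIdeal K 1 mu) : mslMk mu a = 0 :=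
  (Submodule.Quotient.mk_eq_zero _).mpr h

lemma msl_top (mu : K) (W : Submodule (In K 1) (Msl K 1 mu))
    (h : mslMk mu 1 ∈ W) (v : Msl K 1 mu) : v ∈ W := by
  obtain ⟨a, rfl⟩ := Submodule.Quotient.mk_surjective (MslIdeal K 1 mu) v
  have := W.smul_mem a h
  rw [smul_mslMk, mul_one] at this
  exact this

lemma msl_ann (mu : K) (v : Msl K 1 mu) : v ∈ ann (K := K) (Msl K 1 mu) (0 : Fin 1) := by
  refine msl_top mu _ ?_ v
  intro S
  rw [smul_mslMk]
  refine mslMk_zero _ _ ?_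
  refine Submodule.mem_sup_left (Submodule.subset_span ⟨0, S, ?_⟩)
  rw [mul_one, eEl1, e0, sub_mul, mul_assoc, ← pow_succ']
  simp

lemma msl_eig (mu : K) (v : Msl K 1 mu) : v ∈ eig (K := K) (Msl K 1 mu) := by
  refine msl_top mu _ ?_ v
  refine Submodule.subset_span ⟨mu, ?_⟩
  rw [← algebraMap_smul (In K 1) mu, ← sub_eq_zero, ← sub_smul]
  rw [smul_mslMk, mul_one]
  refine mslMk_zero _ _ ?_
  refine Submodule.mem_sup_right (Submodule.subset_span ?_)
  rw [pow_one]; rfl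

lemma P_tor (v : P K 1) : v ∈ tor (K := K) (P K 1) (0 : Fin 1) := by
  induction v using MvPolynomial.induction_on' with
  | add p q hp hq => exact add_mem hp hq
  | monomial α c =>
    have key : ∀ (k : ℕ) (α : Fin 1 →₀ ℕ) (c : K), α 0 = k →
        dEl K 1 0 ^ (k + 1) • (MvPolynomial.monomial α c : P K 1) = 0 := by
      intro k
      induction k with
      | zero => intro α c h; rw [zero_add, pow_one, d_mon, h]; simp
      | succ k ih =>
        intro α c h
        rw [pow_succ, mul_smul, d_mon]
        exact ih _ _ (by simp [h])
    exact ⟨_, key _ α c rfl⟩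

section tensor
variable {M : Type*} [AddCommGroup M] [Module K M] [Module (In K n) M]
  [IsScalarTower K (In K n) M]

lemma tensor_key (Mi : Fin n → ModN K 1) (h : RealizesTensor K n Mi M) (i : Fin n)
    (W : Submodule K M)
    (hW : ∀ L : (Mi i).carrier →ₗ[K] M, (∀ v, L (xEl K 1 0 • v) = xEl K n i • L v) →
      (∀ v, L (dEl K 1 0 • v) = dEl K n i • L v) →
      (∀ v, L (intEl K 1 0 • v) = intEl K n i • L v) → ∀ v, L v ∈ W) (m : M) : m ∈ W := by
  obtain ⟨φ, hφ⟩ := h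
  have hpure : ∀ f : (∀ j, (Mi j).carrier), φ.symm (PiTensorProduct.tprod K f) ∈ W := by
    intro f
    have hact : ∀ (a : In K 1) (v : (Mi i).carrier),
        tprodMap K n Mi i a (PiTensorProduct.tprod K (Function.update f i v))
          = PiTensorProduct.tprod K (Function.update f i (a • v)) := by
      intro a v
      rw [tprodMap, PiTensorProduct.map_tprod]
      congr 1
      funext j
      by_cases hj : j = i
      · subst hj; simp; rfl
      · simp [Function.update_of_ne hj]
    have := hW (φ.symm.toLinearMap ∘ₗ (PiTensorProduct.tprod K).toLinearMap f i)
      (fun v => by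
        apply φ.injective
        simp only [LinearMap.comp_apply, LinearEquiv.coe_coe, LinearEquiv.apply_symm_apply,
          MultilinearMap.toLinearMap_apply, (hφ i _).1, hact])
      (fun v => by
        apply φ.injective
        simp only [LinearMap.comp_apply, LinearEquiv.coe_coe, LinearEquiv.apply_symm_apply,
          MultilinearMap.toLinearMap_apply, (hφ i _).2.1, hact])
      (fun v => by
        apply φ.injective
        simp only [LinearMap.comp_apply, LinearEquiv.coe_coe, LinearEquiv.apply_symm_apply,
          MultilinearMap.toLinearMap_apply, (hφ i _).2.2, hact]) (f i)
    simpa using this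
  have : ∀ t, φ.symm t ∈ W := by
    intro t
    induction t using PiTensorProduct.induction_on with
    | smul_tprod r f => rw [map_smul]; exact W.smul_mem _ (hpure f)
    | add x y hx hy => rw [map_add]; exact W.add_mem hx hy
  simpa using this (φ m)

lemma Lpow {V : Type*} [AddCommGroup V] [Module K V] [Module (In K 1) V] {i : Fin n}
    (L : V →ₗ[K] M) (h : ∀ v, L (dEl K 1 0 • v) = dEl K n i • L v) (S : ℕ) (v : V) :
    L (dEl K 1 0 ^ S • v) = dEl K n i ^ S • L v := by
  induction S generalizing v with
  | zero => simp
  | succ S ih => rw [pow_succ, mul_smul, ih, h, ← mul_smul, ← pow_succ]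

lemma real_tor (lam : Fin n → K) (D : Set (Fin n)) (h : RealizesMD K n lam D M) (i : Fin n)
    (hi : i ∈ D) (m : M) : ∃ S : ℕ, dEl K n i ^ S • m = 0 := by
  obtain ⟨Mi, h1, h2, h3⟩ := h
  obtain ⟨ψ⟩ := h1 i hi
  refine tensor_key Mi h3 i (torK M i) ?_ m
  intro L hx hd hint v
  obtain ⟨S, hS⟩ := P_tor (K := K) (ψ v)
  refine ⟨S, ?_⟩
  rw [← map_smul, LinearEquiv.map_eq_zero_iff] at hS
  rw [← Lpow L hd, hS, map_zero]

lemma real_int (lam : Fin n → K) (D : Set (Fin n)) (h : RealizesMD K n lam D M) (i : Fin n)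
    (hi : i ∉ D) (m : M) : intEl K n i • dEl K n i • m = m := by
  obtain ⟨Mi, h1, h2, h3⟩ := h
  obtain ⟨ψ⟩ := h2 i hi
  have : m ∈ annK (K := K) M i := by
    refine tensor_key Mi h3 i (annK M i) ?_ m
    intro L hx hd hint v S
    have hS := msl_ann (K := K) _ (ψ v) S
    rw [← map_smul, LinearEquiv.map_eq_zero_iff] at hS
    have h0 := congrArg L hS
    rw [e0, sub_mul, one_mul, sub_smul, mul_assoc, mul_smul, mul_smul, map_sub, hint, hd,
      Lpow L hd, map_zero] at h0
    rw [e0, sub_mul, one_mul, sub_smul, mul_assoc, mul_smul, mul_smul]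
    exact h0
  have h0 := this 0
  rw [e0, pow_zero, mul_one, sub_smul, one_smul, mul_smul] at h0
  exact (sub_eq_zero.mp h0).symm

lemma real_eig (lam : Fin n → K) (D : Set (Fin n)) (h : RealizesMD K n lam D M) (i : Fin n)
    (hi : i ∉ D) (m : M) : m ∈ eigK (K := K) M i := by
  obtain ⟨Mi, h1, h2, h3⟩ := h
  obtain ⟨ψ⟩ := h2 i hi
  refine tensor_key Mi h3 i (eigK M i) ?_ m
  intro L hx hd hint v
  have key : ∀ w ∈ eigK (K := K) (Msl K 1 (lam i)) (0 : Fin 1), L (ψ.symm w) ∈ eigK (K := K) M i := by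
    intro w hw
    have hsm : ∀ (c : K) (w), ψ.symm (c • w) = c • ψ.symm w := by
      intro c w
      rw [← algebraMap_smul (In K 1) c, map_smul, algebraMap_smul]
    induction hw using Submodule.span_induction with
    | mem w hw =>
      obtain ⟨mu, hmu⟩ := hw
      refine Submodule.subset_span ⟨mu, ?_⟩
      rw [HEl, mul_smul, ← hx, ← hd, ← mul_smul]
      change L (HEl K 1 0 • _) = _
      rw [← map_smul ψ.symm, hmu, hsm, map_smul]
    | zero => simp
    | add x y _ _ hx hy => rw [map_add, map_add]; exact add_mem hx hy
    | smul r x _ hx => rw [hsm, map_smul]; exact Submodule.smul_mem _ _ hx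
  simpa using key (ψ v) (msl_eig _ _)

end tensor

section final
variable {N : Type*} [AddCommGroup N] [Module K N] [Module (In K n) N]
    [IsScalarTower K (In K n) N] (p : Submodule (In K n) N) (i : Fin n)

lemma intpow_dpow {M : Type*} [AddCommGroup M] [Module (In K n) M]
    (h : ∀ m : M, intEl K n i • dEl K n i • m = m) (S : ℕ) (m : M) :
    intEl K n i ^ S • dEl K n i ^ S • m = m := by
  induction S with
  | zero => simp
  | succ S ih => rw [pow_succ, pow_succ', mul_smul, mul_smul, h, ih]

lemma caseA (hp : ∀ m : p, intEl K n i • dEl K n i • m = m)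
    (hq : ∀ m : N ⧸ p, ∃ S : ℕ, dEl K n i ^ S • m = 0) :
    IsCompl p (tor (K := K) N i) := by
  constructor
  · rw [Submodule.disjoint_def]
    rintro v hv ⟨S, hS⟩
    have := intpow_dpow i hp S ⟨v, hv⟩
    have h2 := congrArg (Subtype.val) this
    simp only [Submodule.coe_smul] at h2
    rw [← h2, hS, smul_zero]
  · rw [codisjoint_iff, eq_top_iff]
    rintro m -
    obtain ⟨S, hS⟩ := hq (Submodule.Quotient.mk m)
    rw [← Submodule.Quotient.mk_smul, Submodule.Quotient.mk_eq_zero] at hS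
    rw [Submodule.mem_sup]
    refine ⟨intEl K n i ^ S • dEl K n i ^ S • m, p.smul_mem _ hS,
      m - intEl K n i ^ S • dEl K n i ^ S • m, ⟨S, ?_⟩, by abel⟩
    rw [smul_sub, ← mul_smul (dEl K n i ^ S) (intEl K n i ^ S), dpow_intpow, one_smul, sub_self]

lemma dpow_H (S : ℕ) : dEl K n i ^ S * HEl K n i
    = HEl K n i * dEl K n i ^ S + (S : In K n) * dEl K n i ^ S := by
  have := dpow_x (K := K) i S
  rw [H_eq, mul_add, add_mul, mul_assoc, ← pow_succ', ← mul_assoc]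
  cases S with
  | zero => simp
  | succ S => rw [dpow_x, add_mul, mul_assoc, ← pow_succ, mul_assoc, ← pow_succ]; simp; abel

lemma caseB_aux (mu : K) (m : N) (S : ℕ)
    (h : dEl K n i ^ S • (HEl K n i • m - mu • m) = 0) :
    ∃ S' : ℕ, ∀ T, S' ≤ T → (e0 i * dEl K n i ^ T) • m = 0 := by
  have key : ∀ T : ℕ, S ≤ T → (1 + (T : K) - mu) • ((e0 i * dEl K n i ^ T) • m) = 0 := by
    intro T hT
    have h1 := dpow_zero_mono i h hT
    have h2 := congrArg (fun z => (e0 i : In K n) • z) h1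
    simp only [smul_zero] at h2
    rw [smul_sub, ← mul_smul, dpow_H, ← smul_comm mu, smul_sub, ← mul_smul, mul_add, ← mul_assoc,
      e_H, add_smul, ← smul_comm mu, ← mul_assoc, ← (Nat.cast_commute T (e0 i)).eq, mul_assoc,
      mul_smul (T : In K n)] at h2
    rw [sub_smul, add_smul, one_smul, Nat.cast_smul_eq_nsmul K]
    rw [Nat.cast_smul_eq_nsmul (In K n), ← mul_smul] at h2
    exact h2
  by_cases hmu : ∃ k : ℕ, mu = k
  · obtain ⟨k, rfl⟩ := hmu
    refine ⟨max S k, fun T hT => ?_⟩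
    refine (smul_eq_zero.mp (key T (le_trans (le_max_left _ _) hT))).resolve_left ?_
    have : k ≤ T := le_trans (le_max_right _ _) hT
    intro h0
    have : ((1 + T : ℕ) : K) = (k : ℕ) := by push_cast; linear_combination h0
    have := Nat.cast_injective this
    omega
  · refine ⟨S, fun T hT => ?_⟩
    refine (smul_eq_zero.mp (key T hT)).resolve_left ?_
    intro h0
    exact hmu ⟨1 + T, by push_cast; linear_combination -h0⟩

lemma ann_fix {M : Type*} [AddCommGroup M] [Module (In K n) M] (v : M)
    (h : ∀ S : ℕ, (e0 i * dEl K n i ^ S) • v = 0) (S : ℕ) :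
    intEl K n i ^ S • dEl K n i ^ S • v = v := by
  induction S with
  | zero => simp
  | succ S ih =>
    have h0 := h S
    rw [e0, sub_mul, one_mul, sub_smul, mul_assoc, ← pow_succ', mul_smul, sub_eq_zero] at h0
    rw [pow_succ (intEl K n i), mul_smul, ← h0, ih]

lemma caseB (hp : ∀ m : p, ∃ S : ℕ, dEl K n i ^ S • m = 0)
    (hq : ∀ m : N ⧸ p, intEl K n i • dEl K n i • m = m)
    (hq' : ∀ m : N ⧸ p, m ∈ eigK (K := K) (N ⧸ p) i) :
    IsCompl p (ann (K := K) N i) := by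
  constructor
  · rw [Submodule.disjoint_def]
    intro v hv hva
    obtain ⟨S, hS⟩ := hp ⟨v, hv⟩
    have h2 := congrArg (Subtype.val) hS
    simp only [Submodule.coe_smul, Submodule.coe_zero] at h2
    rw [← ann_fix i v hva S, h2, smul_zero]
  · rw [codisjoint_iff, eq_top_iff]
    have key : ∀ w ∈ eigK (K := K) (N ⧸ p) i, ∀ m : N, Submodule.Quotient.mk m = w →
        m ∈ p ⊔ ann (K := K) N i := by
      intro w hw
      induction hw using Submodule.span_induction with
      | mem w hw =>
        obtain ⟨mu, hmu⟩ := hw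
        rintro m rfl
        have hmem : HEl K n i • m - mu • m ∈ p := by
          rw [← Submodule.Quotient.mk_eq_zero, Submodule.Quotient.mk_sub, sub_eq_zero]
          exact hmu
        obtain ⟨S, hS⟩ := hp ⟨_, hmem⟩
        have hS2 := congrArg (Subtype.val) hS
        simp only [Submodule.coe_smul, Submodule.coe_zero] at hS2
        obtain ⟨S', hS'⟩ := caseB_aux i mu m S hS2
        rw [Submodule.mem_sup]
        refine ⟨m - intEl K n i ^ S' • dEl K n i ^ S' • m, ?_,
          intEl K n i ^ S' • dEl K n i ^ S' • m, ?_, by abel⟩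
        · rw [← Submodule.Quotient.mk_eq_zero, Submodule.Quotient.mk_sub, sub_eq_zero]
          exact (intpow_dpow i hq S' (Submodule.Quotient.mk m)).symm
        · intro T
          rcases Nat.lt_or_ge T S' with hT | hT
          · obtain ⟨k, rfl⟩ := Nat.exists_eq_add_of_lt hT
            rw [add_assoc, pow_add (intEl K n i), ← mul_smul, mul_assoc,
              ← mul_assoc (dEl K n i ^ T), dpow_intpow, one_mul,
              pow_succ' (intEl K n i), ← mul_assoc, e_int, zero_mul, zero_smul]
          · obtain ⟨k, rfl⟩ := Nat.exists_eq_add_of_le hT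
            have := hS' (S' + k) hT
            rw [← mul_smul, ← mul_smul]
            have h5 : e0 i * dEl K n i ^ (S' + k) * (intEl K n i ^ S' * dEl K n i ^ S')
              = e0 i * dEl K n i ^ (S' + k) := by
              rw [add_comm, pow_add, mul_assoc, mul_assoc, ← mul_assoc (dEl K n i ^ S'),
                dpow_intpow, one_mul]
            rw [mul_assoc (e0 i * _), h5]
            exact this
      | zero =>
        intro m hm
        exact Submodule.mem_sup_left ((Submodule.Quotient.mk_eq_zero p).mp hm)
      | add x y _ _ hx hy =>
        intro m hm
        obtain ⟨x, rfl⟩ := Submodule.Quotient.mk_surjective p x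
        have := add_mem (hx x rfl) (hy (m - x) (by
          rw [Submodule.Quotient.mk_sub, hm, add_sub_cancel_left]))
        simpa using this
      | smul r x _ hx =>
        intro m hm
        obtain ⟨x, rfl⟩ := Submodule.Quotient.mk_surjective p x
        have h1 := hx x rfl
        have h2 : m - r • x ∈ p := by
          rw [← Submodule.Quotient.mk_eq_zero, Submodule.Quotient.mk_sub, hm, sub_eq_zero]
          rfl
        have h3 := Submodule.smul_mem _ (algebraMap K (In K n) r) h1
        rw [algebraMap_smul] at h3
        have := add_mem (Submodule.mem_sup_left (T := ann (K := K) N i) h2) h3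
        simpa using this
    intro m _
    exact key _ (hq' _) m rfl

end final
end S10

/-- `Ext¹(M(𝒟'_Ω), M(𝒟_Ω)) = 0` for distinct `𝒟_Ω, 𝒟'_Ω ⊆ 𝔻_Ω`: every short
exact sequence `0 → M(𝒟_Ω) → N → M(𝒟'_Ω) → 0` splits. -/
theorem statement10 (K : Type*) [Field K] [CharZero K] (n : ℕ)
    (lam : Fin n → K) (hnorm : IsNormalized K n lam)
    (D : Set (Fin n)) (hD : D ⊆ DD K n lam)
    (D' : Set (Fin n)) (hD' : D' ⊆ DD K n lam) (hne : D ≠ D')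
    (N : Type*) [AddCommGroup N] [Module K N] [Module (In K n) N]
    [IsScalarTower K (In K n) N]
    (p : Submodule (In K n) N)
    (hsub : RealizesMD K n lam D p)
    (hquot : RealizesMD K n lam D' (N ⧸ p)) :
    ∃ q : Submodule (In K n) N, IsCompl p q := by
  have hex : ∃ i, ¬ (i ∈ D ↔ i ∈ D') := by
    by_contra hcon
    push Not at hcon
    exact hne (Set.ext hcon)
  obtain ⟨i, hi⟩ := hex
  by_cases h : i ∈ D
  · have h' : i ∉ D' := fun h' => hi ⟨fun _ => h', fun _ => h⟩
    exact ⟨_, S10.caseB p i (S10.real_tor lam D hsub i h) (S10.real_int lam D' hquot i h')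
      (S10.real_eig lam D' hquot i h')⟩
  · have h' : i ∈ D' := by
      by_contra h'
      exact hi ⟨fun x => absurd x h, fun x => absurd x h'⟩
    exact ⟨_, S10.caseA p i (S10.real_int lam D hsub i h) (S10.real_tor lam D' hquot i h')⟩

end IDO
end
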